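/- arXiv:2601.00957 — 4 statements merged into one kernel-verified Lean document; each statement's English description precedes it below -/
import Mathlib

section
/- Let G be a finite split graph with clique number ω(G) and independence number α(G), and let (A,B) be any KS-partition of G. Then exactly one of the following holds: (i) |A| = ω(G) and |B| = α(G); (ii) |A| = ω(G) and |B| = α(G) − 1; (iii) |A| = ω(G) − 1 and |B| = α(G). Moreover, in case (ii) there exists a vertex u ∈ A such that B ∪ {u} is an independent set, and in case (iii) there exists a vertex v ∈ B such that A ∪ {v} is a clique. -/
namespace Tysh

open SimpleGraph

variable {V : Type}

/-- A set of vertices is independent (stable). -/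
def IsIndep (G : SimpleGraph V) (s : Set V) : Prop :=
  ∀ ⦃u⦄, u ∈ s → ∀ ⦃v⦄, v ∈ s → u ≠ v → ¬ G.Adj u v

/-- `(A, B)` is a KS-partition of `G`: `A` induces a clique, `B` an independent set,
and they partition the vertex set. -/
def IsKSPartition (G : SimpleGraph V) (A B : Set V) : Prop :=
  G.IsClique A ∧ IsIndep G B ∧ A ∪ B = Set.univ ∧ Disjoint A B

/-- A split graph is one admitting a KS-partition. -/
def IsSplit (G : SimpleGraph V) : Prop := ∃ A B, IsKSPartition G A B

/-- Independence number. -/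
noncomputable def indepNum (G : SimpleGraph V) : ℕ := Gᶜ.cliqueNum

/-- `G` is decomposable: its vertices can be partitioned into `A ∪ B` (a nonempty split
graph with KS-partition `(A,B)`) and a nonempty part `W`, with all `A`–`W` edges present
and no `B`–`W` edges; i.e. `G` is (isomorphic to) the composition `(G[A∪B],A,B) ∘ G[W]`. -/
def Decomposable (G : SimpleGraph V) : Prop :=
  ∃ A B W : Set V,
    (A ∪ B) ∪ W = Set.univ ∧ Disjoint A B ∧ Disjoint (A ∪ B) W ∧
    (A ∪ B).Nonempty ∧ W.Nonempty ∧
    G.IsClique A ∧ IsIndep G B ∧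
    (∀ a ∈ A, ∀ w ∈ W, G.Adj a w) ∧
    (∀ b ∈ B, ∀ w ∈ W, ¬ G.Adj b w)

/-- The composition `(G,A,B) ∘ H` of a split graph `G` (with clique part `A`)
with a graph `H`. -/
def comp {α β : Type} (G : SimpleGraph α) (A : Set α) (H : SimpleGraph β) :
    SimpleGraph (α ⊕ β) :=
  SimpleGraph.fromRel (fun x y =>
    match x, y with
    | .inl a, .inl a' => G.Adj a a'
    | .inr b, .inr b' => H.Adj b b'
    | .inl a, .inr _ => a ∈ A
    | .inr _, .inl _ => False)

/-- The iterated composition `(G_k,A_k,B_k) ∘ ⋯ ∘ (G_1,A_1,B_1) ∘ G_0`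
(component `0` is `G_0`; the clique part `A i` of component `i` is joined to
all components with smaller index). -/
def iterComp {k : ℕ} {Vi : Fin (k+1) → Type} (Gi : ∀ i, SimpleGraph (Vi i))
    (A : ∀ i, Set (Vi i)) : SimpleGraph (Σ i, Vi i) :=
  SimpleGraph.fromRel (fun x y =>
    (∃ h : x.1 = y.1, (Gi y.1).Adj (h ▸ x.2) y.2) ∨ (y.1 < x.1 ∧ x.2 ∈ A x.1))

/-- The multiset of vertex degrees of a finite graph. -/
noncomputable def degMultiset {V : Type} [Fintype V] (G : SimpleGraph V) : Multiset ℕ :=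
  Finset.univ.val.map fun v => (G.neighborSet v).ncard

/-- A unigraph is a graph determined up to isomorphism by its degree sequence. -/
def Unigraph {V : Type} [Fintype V] (G : SimpleGraph V) : Prop :=
  ∀ (W : Type) [Fintype W] (H : SimpleGraph W),
    degMultiset G = degMultiset H → Nonempty (G ≃g H)


theorem IsIndep.isClique_compl {G : SimpleGraph V} {s : Set V} (h : IsIndep G s) :
    Gᶜ.IsClique s := fun u hu v hv huv => by
  simpa [SimpleGraph.compl_adj, huv] using h hu hv huv

theorem isIndep_of_isClique_compl {G : SimpleGraph V} {s : Set V} (h : Gᶜ.IsClique s) :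
    IsIndep G s := fun _ hu _ hv huv => ((G.compl_adj _ _).1 (h hu hv huv)).2

theorem isIndep_compl_of_isClique {G : SimpleGraph V} {s : Set V} (h : G.IsClique s) :
    IsIndep Gᶜ s := fun _ hu _ hv huv hadj => ((G.compl_adj _ _).1 hadj).2 (h hu hv huv)

/-- Complementing the graph swaps the two parts of a KS-partition. -/
theorem IsKSPartition.compl {G : SimpleGraph V} {A B : Set V} (h : IsKSPartition G A B) :
    IsKSPartition Gᶜ B A :=
  ⟨h.2.1.isClique_compl, isIndep_compl_of_isClique h.1, Set.union_comm A B ▸ h.2.2.1,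
    h.2.2.2.symm⟩

theorem ncard_le_cliqueNum [Finite V] {G : SimpleGraph V} {s : Set V} (h : G.IsClique s) :
    s.ncard ≤ G.cliqueNum := by
  have hs : G.IsClique (s.toFinite.toFinset : Set V) := by simpa using h
  rw [Set.ncard_eq_toFinset_card s]
  exact hs.card_le_cliqueNum

/-- The clique part of a KS-partition is either a maximum clique, or one vertex of the independent
part short of being one. -/
theorem IsKSPartition.cliqueNum_eq_or [Finite V] {G : SimpleGraph V} {A B : Set V}
    (h : IsKSPartition G A B) :
    G.cliqueNum = A.ncard ∨ G.cliqueNum = A.ncard + 1 ∧ ∃ v ∈ B, G.IsClique (A ∪ {v}) := by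
  obtain ⟨hA, hB, hAB, -⟩ := h
  have mem_B : ∀ w, w ∉ A → w ∈ B := fun w hw =>
    ((Set.mem_union w A B).1 (hAB ▸ Set.mem_univ w)).resolve_left hw
  have hle := ncard_le_cliqueNum hA
  obtain ⟨K, hK, hKcard⟩ := G.exists_isNClique_cliqueNum
  rw [← Set.ncard_coe_finset] at hKcard
  by_cases hKA : (K : Set V) ⊆ A
  · have := Set.ncard_le_ncard hKA
    left; omega
  obtain ⟨v, hvK, hvA⟩ := Set.not_subset.1 hKA
  have hsub : (K : Set V) ⊆ A ∪ {v} := by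
    intro w hw
    by_contra hwAv
    simp only [Set.mem_union, Set.mem_singleton_iff, not_or] at hwAv
    exact hB (mem_B w hwAv.1) (mem_B v hvA) hwAv.2 (hK hw hvK hwAv.2)
  have hcard : (A ∪ {v}).ncard = A.ncard + 1 := by
    rw [Set.union_singleton, Set.ncard_insert_of_notMem hvA]
  have := Set.ncard_le_ncard hsub
  rcases hle.eq_or_lt with heq | hlt
  · exact Or.inl heq.symm
  · have hKeq := Set.eq_of_subset_of_ncard_le hsub (by omega)
    exact Or.inr ⟨by omega, v, mem_B v hvA, hKeq ▸ hK⟩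

/-- **Hammer–Simeone.** For any KS-partition `(A,B)` of a finite split graph `G`, exactly
one of (i) `|A| = ω(G), |B| = α(G)`, (ii) `|A| = ω(G), |B| = α(G) − 1`,
(iii) `|A| = ω(G) − 1, |B| = α(G)` holds. Moreover, in case (ii) there is `u ∈ A` with
`B ∪ {u}` independent, and in case (iii) there is `v ∈ B` with `A ∪ {v}` a clique. -/
theorem hammer_simeone {V : Type} [Fintype V] (G : SimpleGraph V) (A B : Set V)
    (hsplit : IsSplit G) (hKS : IsKSPartition G A B) :
    ((((A.ncard : ℤ) = G.cliqueNum ∧ (B.ncard : ℤ) = indepNum G) ∧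
        ¬((A.ncard : ℤ) = G.cliqueNum ∧ (B.ncard : ℤ) = (indepNum G : ℤ) - 1) ∧
        ¬((A.ncard : ℤ) = (G.cliqueNum : ℤ) - 1 ∧ (B.ncard : ℤ) = indepNum G)) ∨
      ((¬((A.ncard : ℤ) = G.cliqueNum ∧ (B.ncard : ℤ) = indepNum G)) ∧
        ((A.ncard : ℤ) = G.cliqueNum ∧ (B.ncard : ℤ) = (indepNum G : ℤ) - 1) ∧
        ¬((A.ncard : ℤ) = (G.cliqueNum : ℤ) - 1 ∧ (B.ncard : ℤ) = indepNum G)) ∨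
      ((¬((A.ncard : ℤ) = G.cliqueNum ∧ (B.ncard : ℤ) = indepNum G)) ∧
        (¬((A.ncard : ℤ) = G.cliqueNum ∧ (B.ncard : ℤ) = (indepNum G : ℤ) - 1)) ∧
        ((A.ncard : ℤ) = (G.cliqueNum : ℤ) - 1 ∧ (B.ncard : ℤ) = indepNum G))) ∧
    (((A.ncard : ℤ) = G.cliqueNum ∧ (B.ncard : ℤ) = (indepNum G : ℤ) - 1) →
      ∃ u ∈ A, IsIndep G (B ∪ {u})) ∧
    (((A.ncard : ℤ) = (G.cliqueNum : ℤ) - 1 ∧ (B.ncard : ℤ) = indepNum G) →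
      ∃ v ∈ B, G.IsClique (A ∪ {v})) := by
  have hω := hKS.cliqueNum_eq_or
  have hα : indepNum G = B.ncard ∨
      indepNum G = B.ncard + 1 ∧ ∃ u ∈ A, IsIndep G (B ∪ {u}) :=
    hKS.compl.cliqueNum_eq_or.imp_right fun ⟨hcard, u, hu, hBu⟩ =>
      ⟨hcard, u, hu, isIndep_of_isClique_compl hBu⟩
  have not_both : ¬((∃ v ∈ B, G.IsClique (A ∪ {v})) ∧ ∃ u ∈ A, IsIndep G (B ∪ {u})) := by
    rintro ⟨⟨v, hv, hAv⟩, u, hu, hBu⟩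
    have huv : u ≠ v := hKS.2.2.2.ne_of_mem hu hv
    exact hBu (Or.inr rfl) (Or.inl hv) huv (hAv (Or.inl hu) (Or.inr rfl) huv)
  refine ⟨?_, fun ⟨_, hB⟩ => ?_, fun ⟨hA, _⟩ => ?_⟩
  · rcases hω with hω | ⟨hω, hv⟩ <;> rcases hα with hα | ⟨hα, hu⟩
    · omega
    · omega
    · omega
    · exact absurd ⟨hv, hu⟩ not_both
  · exact (hα.resolve_left (by omega)).2
  · exact (hω.resolve_left (by omega)).2

end Tysh
end

section
/- Let G* be a finite simple graph on N vertices with degree sequence d_1 ≥ d_2 ≥ ⋯ ≥ d_N. Then G* is decomposable if and only if there exist integers p, q ≥ 0 with 0 < p + q < N such that Σ_{i=1}^{p} d_i = p(N − q − 1) + Σ_{i=N−q+1}^{N} d_i. Moreover, if such p and q exist, then G* is isomorphic to a composition (G,A,B) ∘ H in which |A| = p, |B| = q, the vertices of A have degrees d_1,…,d_p in G*, the vertices of H have degrees d_{p+1},…,d_{N−q} in G*, and the vertices of B have degrees d_{N−q+1},…,d_N in G*. -/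
namespace Tysh

open SimpleGraph

variable {V : Type}

/-- If `S` and `T` have the same size and `f` is everywhere at least as large on `T \ S` as on
`S \ T`, then the sum of `f` over `T` is at least its sum over `S`. -/
lemma sum_le_sum_of_card_eq {α : Type*} [DecidableEq α] (f : α → ℕ) {S T : Finset α}
    (hcard : S.card = T.card) (h : ∀ i ∈ S \ T, ∀ j ∈ T \ S, f i ≤ f j) :
    ∑ i ∈ S, f i ≤ ∑ i ∈ T, f i := by
  have hsdiff : (S \ T).card = (T \ S).card := Finset.card_sdiff_comm hcard
  rw [← Finset.sum_inter_add_sum_sdiff S T f, ← Finset.sum_inter_add_sum_sdiff T S f,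
    Finset.inter_comm T S]
  refine Nat.add_le_add_left ?_ _
  calc ∑ i ∈ S \ T, f i ≤ (S \ T).card • (S \ T).sup f :=
        Finset.sum_le_card_nsmul _ _ _ fun i hi => Finset.le_sup hi
    _ = (T \ S).card • (S \ T).sup f := by rw [hsdiff]
    _ ≤ ∑ j ∈ T \ S, f j :=
        Finset.card_nsmul_le_sum _ _ _ fun j hj => Finset.sup_le fun i hi => h i hi j hj

open Classical in
/-- The degree sums over disjoint sets `A` and `B`, with the defect from `A` being completely
joined to the complement of `B` and `B` being completely non-adjacent to the complement of `A`. -/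
lemma sum_degree_add_defect {α : Type*} [Fintype α] (G : SimpleGraph α) {A B : Finset α}
    (hAB : Disjoint A B) :
    ∑ a ∈ A, (G.neighborSet a).ncard + ∑ a ∈ A, {v ∈ Bᶜ | v ≠ a ∧ ¬ G.Adj a v}.card +
        ∑ b ∈ B, {v ∈ Aᶜ | G.Adj b v}.card =
      A.card * (Fintype.card α - B.card - 1) + ∑ b ∈ B, (G.neighborSet b).ncard := by
  have hsplit (C : Finset α) (v : α) :
      (G.neighborSet v).ncard = {w ∈ C | G.Adj v w}.card + {w ∈ Cᶜ | G.Adj v w}.card := by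
    rw [← Finset.card_union_of_disjoint
      (Finset.disjoint_filter_filter disjoint_compl_right), ← Finset.filter_union,
      Finset.union_compl, ← Set.ncard_coe_finset]
    congr 1
    ext w
    simp
  have hA (a : α) (ha : a ∈ A) : (G.neighborSet a).ncard + {v ∈ Bᶜ | v ≠ a ∧ ¬ G.Adj a v}.card =
      {w ∈ B | G.Adj a w}.card + (Fintype.card α - B.card - 1) := by
    rw [hsplit B, add_assoc, ← Finset.card_compl,
      ← Finset.card_erase_of_mem (Finset.mem_compl.2 (Finset.disjoint_left.1 hAB ha)),
      ← Finset.card_union_of_disjoint]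
    · congr 2
      ext v
      have : G.Adj a v → v ≠ a := fun h => h.ne'
      simp only [Finset.mem_union, Finset.mem_filter, Finset.mem_erase]
      tauto
    · exact Finset.disjoint_filter.2 fun v _ h h' => h'.2 h
  have hcross : ∑ a ∈ A, {w ∈ B | G.Adj a w}.card = ∑ b ∈ B, {w ∈ A | G.Adj b w}.card := by
    simpa only [Finset.bipartiteAbove, Finset.bipartiteBelow, G.adj_comm] using
      Finset.sum_card_bipartiteAbove_eq_sum_card_bipartiteBelow (s := A) (t := B) G.Adj
  rw [← Finset.sum_add_distrib, Finset.sum_congr rfl hA, Finset.sum_add_distrib, hcross,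
    Finset.sum_congr rfl fun b _ => hsplit A b, Finset.sum_add_distrib, Finset.sum_const,
    smul_eq_mul]
  ring

lemma sum_degree_le {α : Type*} [Fintype α] (G : SimpleGraph α) {A B : Finset α}
    (hAB : Disjoint A B) :
    ∑ a ∈ A, (G.neighborSet a).ncard ≤
      A.card * (Fintype.card α - B.card - 1) + ∑ b ∈ B, (G.neighborSet b).ncard := by
  rw [← sum_degree_add_defect G hAB, add_assoc]
  exact Nat.le_add_right _ _

lemma sum_degree_eq_iff {α : Type*} [Fintype α] (G : SimpleGraph α) {A B : Finset α}
    (hAB : Disjoint A B) :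
    ∑ a ∈ A, (G.neighborSet a).ncard =
        A.card * (Fintype.card α - B.card - 1) + ∑ b ∈ B, (G.neighborSet b).ncard ↔
      (∀ a ∈ A, ∀ v ∉ B, v ≠ a → G.Adj a v) ∧ (∀ b ∈ B, ∀ v ∉ A, ¬ G.Adj b v) := by
  classical
  rw [← sum_degree_add_defect G hAB, add_assoc, left_eq_add, Nat.add_eq_zero_iff]
  simp [Finset.sum_eq_zero_iff, Finset.filter_eq_empty_iff]


/-- **Tyshkevich.** A graph on `N` vertices with nonincreasing degree sequence
`d 0 ≥ d 1 ≥ ⋯ ≥ d (N-1)` is decomposable iff there are `p, q` with `0 < p + q < N` and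
`∑_{i<p} d i = p(N − q − 1) + ∑_{i ≥ N−q} d i`; and in that case `G` is a composition
`(G,A,B) ∘ H` where `|A| = p`, `|B| = q`, and the vertices of `A`, `H`, `B` carry the
degrees `d 0, …, d (p-1)`, `d p, …, d (N-q-1)`, `d (N-q), …, d (N-1)` respectively. -/
theorem decomposable_iff_degree_condition {N : ℕ} (G : SimpleGraph (Fin N))
    (d : Fin N → ℕ) (hanti : Antitone d)
    (hdeg : ∃ σ : Equiv.Perm (Fin N), ∀ i, d i = (G.neighborSet (σ i)).ncard) :
    (Decomposable G ↔ ∃ p q : ℕ, 0 < p + q ∧ p + q < N ∧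
      ∑ i ∈ Finset.univ.filter (fun i : Fin N => (i : ℕ) < p), d i =
        p * (N - q - 1) +
          ∑ i ∈ Finset.univ.filter (fun i : Fin N => N - q ≤ (i : ℕ)), d i) ∧
    (∀ p q : ℕ, 0 < p + q → p + q < N →
      (∑ i ∈ Finset.univ.filter (fun i : Fin N => (i : ℕ) < p), d i =
        p * (N - q - 1) +
          ∑ i ∈ Finset.univ.filter (fun i : Fin N => N - q ≤ (i : ℕ)), d i) →
      ∃ A B W : Set (Fin N),
        (A ∪ B) ∪ W = Set.univ ∧ Disjoint A B ∧ Disjoint (A ∪ B) W ∧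
        (A ∪ B).Nonempty ∧ W.Nonempty ∧
        G.IsClique A ∧ IsIndep G B ∧
        (∀ a ∈ A, ∀ w ∈ W, G.Adj a w) ∧
        (∀ b ∈ B, ∀ w ∈ W, ¬ G.Adj b w) ∧
        A.ncard = p ∧ B.ncard = q ∧
        ∃ σ : Equiv.Perm (Fin N), (∀ i, d i = (G.neighborSet (σ i)).ncard) ∧
          (∀ i, σ i ∈ A ↔ (i : ℕ) < p) ∧
          (∀ i, σ i ∈ W ↔ p ≤ (i : ℕ) ∧ (i : ℕ) < N - q) ∧
          (∀ i, σ i ∈ B ↔ N - q ≤ (i : ℕ))) := by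
  classical
  obtain ⟨σ, hσ⟩ := hdeg
  set T : ℕ → Finset (Fin N) := fun p =>
    (Finset.univ.filter fun i : Fin N => (i : ℕ) < p).map σ.toEmbedding with hT
  set U : ℕ → Finset (Fin N) := fun q =>
    (Finset.univ.filter fun i : Fin N => N - q ≤ (i : ℕ)).map σ.toEmbedding with hU
  have memT (p : ℕ) (i : Fin N) : σ i ∈ T p ↔ (i : ℕ) < p := by simp [hT]
  have memU (q : ℕ) (i : Fin N) : σ i ∈ U q ↔ N - q ≤ (i : ℕ) := by simp [hU]
  have sumT (p : ℕ) : ∑ i ∈ Finset.univ.filter (fun i : Fin N => (i : ℕ) < p), d i =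
      ∑ v ∈ T p, (G.neighborSet v).ncard := by simp [hT, hσ]
  have sumU (q : ℕ) : ∑ i ∈ Finset.univ.filter (fun i : Fin N => N - q ≤ (i : ℕ)), d i =
      ∑ v ∈ U q, (G.neighborSet v).ncard := by simp [hU, hσ]
  have cardT (p : ℕ) (hp : p ≤ N) : (T p).card = p := by
    simp [hT, Fin.card_filter_val_lt, hp]
  have cardU (q : ℕ) (hq : q ≤ N) : (U q).card = q := by
    have h := Finset.card_filter_add_card_filter_not (s := (Finset.univ : Finset (Fin N)))
      (fun i : Fin N => (i : ℕ) < N - q)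
    simp only [not_lt, Fin.card_filter_val_lt, Finset.card_univ, Fintype.card_fin] at h
    simp only [hU, Finset.card_map]
    omega
  have disjTU (p q : ℕ) (hpq : p + q < N) : Disjoint (T p) (U q) := by
    refine Finset.disjoint_left.2 fun v hvT hvU => ?_
    obtain ⟨i, rfl⟩ := σ.surjective v
    rw [memT] at hvT
    rw [memU] at hvU
    omega
  have hsecond : ∀ p q : ℕ, 0 < p + q → p + q < N →
      (∑ i ∈ Finset.univ.filter (fun i : Fin N => (i : ℕ) < p), d i =
        p * (N - q - 1) +
          ∑ i ∈ Finset.univ.filter (fun i : Fin N => N - q ≤ (i : ℕ)), d i) →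
      ∃ A B W : Set (Fin N),
        (A ∪ B) ∪ W = Set.univ ∧ Disjoint A B ∧ Disjoint (A ∪ B) W ∧
        (A ∪ B).Nonempty ∧ W.Nonempty ∧
        G.IsClique A ∧ IsIndep G B ∧
        (∀ a ∈ A, ∀ w ∈ W, G.Adj a w) ∧
        (∀ b ∈ B, ∀ w ∈ W, ¬ G.Adj b w) ∧
        A.ncard = p ∧ B.ncard = q ∧
        ∃ σ : Equiv.Perm (Fin N), (∀ i, d i = (G.neighborSet (σ i)).ncard) ∧
          (∀ i, σ i ∈ A ↔ (i : ℕ) < p) ∧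
          (∀ i, σ i ∈ W ↔ p ≤ (i : ℕ) ∧ (i : ℕ) < N - q) ∧
          (∀ i, σ i ∈ B ↔ N - q ≤ (i : ℕ)) := by
    intro p q hpos hlt heq
    have hdisj := disjTU p q hlt
    rw [sumT, sumU] at heq
    obtain ⟨hA, hB⟩ := (sum_degree_eq_iff G hdisj).1 (by
      rwa [cardT p (by omega), cardU q (by omega), Fintype.card_fin])
    have hne : (T p ∪ U q).Nonempty := by
      rw [← Finset.card_pos, Finset.card_union_of_disjoint hdisj, cardT p (by omega),
        cardU q (by omega)]
      exact hpos
    refine ⟨T p, U q, (T p ∪ U q : Set (Fin N))ᶜ, Set.union_compl_self _,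
      Finset.disjoint_coe.2 hdisj, disjoint_compl_right, by rwa [← Finset.coe_union, Finset.coe_nonempty],
      ⟨σ ⟨p, by omega⟩, ?_⟩, ?_, ?_, ?_, ?_, ?_, ?_, σ, hσ, ?_, ?_, ?_⟩
    · simp only [Set.mem_compl_iff, Set.mem_union, Finset.mem_coe, memT, memU]
      omega
    · exact fun u hu v hv huv => hA u hu v (Finset.disjoint_left.1 hdisj hv) huv.symm
    · exact fun u hu v hv _ => hB u hu v (Finset.disjoint_right.1 hdisj hv)
    · exact fun a ha w hw => hA a ha w (fun h => hw (Or.inr h)) fun h => hw (Or.inl (h ▸ ha))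
    · exact fun b hb w hw => hB b hb w fun h => hw (Or.inl h)
    · rw [Set.ncard_coe_finset, cardT p (by omega)]
    · rw [Set.ncard_coe_finset, cardU q (by omega)]
    · exact fun i => memT p i
    · intro i
      simp only [Set.mem_compl_iff, Set.mem_union, Finset.mem_coe, memT, memU]
      omega
    · exact fun i => memU q i
  refine ⟨⟨?_, ?_⟩, hsecond⟩
  · rintro ⟨A, B, W, hcover, hAB, hdisjW, hne, hWne, hA, hB, hAW, hBW⟩
    lift A to Finset (Fin N) using A.toFinite
    lift B to Finset (Fin N) using B.toFinite
    rw [Finset.disjoint_coe] at hAB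
    have hcard : A.card + B.card = (A ∪ B).card := (Finset.card_union_of_disjoint hAB).symm
    have hpos : 0 < A.card + B.card := by
      rwa [hcard, Finset.card_pos, ← Finset.coe_nonempty, Finset.coe_union]
    have hlt : A.card + B.card < N := by
      obtain ⟨w, hw⟩ := hWne
      have hw' : w ∉ A ∪ B := fun h =>
        Set.disjoint_left.1 hdisjW (by rwa [← Finset.coe_union, Finset.mem_coe]) hw
      simpa [hcard] using Finset.card_lt_univ_of_notMem hw'
    have hmem (v : Fin N) : v ∈ A ∨ v ∈ B ∨ v ∈ W := by
      have hv := Set.mem_univ v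
      rw [← hcover] at hv
      simpa [or_assoc] using hv
    have heq := (sum_degree_eq_iff G hAB).2
      ⟨fun a ha v hv hva => by
        rcases hmem v with h | h | h
        · exact hA ha h hva.symm
        · exact absurd h hv
        · exact hAW a ha v h,
      fun b hb v hv => by
        rcases hmem v with h | h | h
        · exact absurd h hv
        · exact fun hadj => hB hb h hadj.ne hadj
        · exact hBW b hb v h⟩
    have hT' := cardT A.card (by omega)
    have hU' := cardU B.card (by omega)
    have hle := sum_degree_le G (disjTU _ _ hlt)
    have hAT : ∑ v ∈ A, (G.neighborSet v).ncard ≤ ∑ v ∈ T A.card, (G.neighborSet v).ncard := by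
      refine sum_le_sum_of_card_eq _ hT'.symm fun u hu v hv => ?_
      obtain ⟨i, rfl⟩ := σ.surjective u
      obtain ⟨j, rfl⟩ := σ.surjective v
      rw [Finset.mem_sdiff, memT] at hu hv
      rw [← hσ, ← hσ]
      exact hanti (Fin.le_def.2 (by omega))
    have hUB : ∑ v ∈ U B.card, (G.neighborSet v).ncard ≤ ∑ v ∈ B, (G.neighborSet v).ncard := by
      refine sum_le_sum_of_card_eq _ hU' fun u hu v hv => ?_
      obtain ⟨i, rfl⟩ := σ.surjective u
      obtain ⟨j, rfl⟩ := σ.surjective v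
      rw [Finset.mem_sdiff, memU] at hu hv
      rw [← hσ, ← hσ]
      exact hanti (Fin.le_def.2 (by omega))
    refine ⟨A.card, B.card, hpos, hlt, ?_⟩
    rw [sumT, sumU]
    rw [hT', hU', Fintype.card_fin] at hle
    rw [Fintype.card_fin] at heq
    omega
  · rintro ⟨p, q, hpos, hlt, heq⟩
    obtain ⟨A, B, W, h1, h2, h3, h4, h5, h6, h7, h8, h9, -⟩ := hsecond p q hpos hlt heq
    exact ⟨A, B, W, h1, h2, h3, h4, h5, h6, h7, h8, h9⟩

end Tysh
end

section
/- Every finite simple graph G* can be written as an iterated composition G* ≅ (G_k,A_k,B_k) ∘ (G_{k−1},A_{k−1},B_{k−1}) ∘ ⋯ ∘ (G_1,A_1,B_1) ∘ G_0 in which each (G_i,A_i,B_i) for i ≥ 1 is an indecomposable split graph with a chosen KS-partition and G_0 is an indecomposable graph. This decomposition is canonical: if also G* ≅ (G'_ℓ,A'_ℓ,B'_ℓ) ∘ ⋯ ∘ (G'_1,A'_1,B'_1) ∘ G'_0 with each (G'_i,A'_i,B'_i) an indecomposable split graph and G'_0 indecomposable, then k = ℓ, G_0 ≅ G'_0, and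 for each i = 1,…,k there is a graph isomorphism from G_i to G'_i carrying A_i onto A'_i and B_i onto B'_i. -/
namespace Tysh

open SimpleGraph

variable {V : Type}

/-- A decomposition of `G` into indecomposable components in the sense of Tyshkevich:
`G ≅ (G_k,A_k,B_k) ∘ ⋯ ∘ (G_1,A_1,B_1) ∘ G_0`, where each `(G_i,A_i,B_i)`, `i ≥ 1`, is an
indecomposable split graph with a chosen KS-partition and `G_0` is an indecomposable
graph. -/
structure CanonDecomp {V : Type} [Fintype V] (G : SimpleGraph V) where
  k : ℕ
  Vi : Fin (k + 1) → Type
  fin : ∀ i, Fintype (Vi i)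
  nonemp : ∀ i, Nonempty (Vi i)
  Gi : ∀ i, SimpleGraph (Vi i)
  A : ∀ i, Set (Vi i)
  B : ∀ i, Set (Vi i)
  ksp : ∀ i, i ≠ 0 → IsKSPartition (Gi i) (A i) (B i)
  hA0 : A 0 = ∅
  hB0 : B 0 = ∅
  indec : ∀ i, ¬ Decomposable (Gi i)
  iso : G ≃g iterComp Gi A

/-- `T ⊆ S` is a nonempty proper part of `S` which splits into the clique `T ∩ C`, complete to
`S \ T`, and the independent set `T \ C`, anticomplete to `S \ T`. -/
structure IsCut (G : SimpleGraph V) (S T C : Set V) : Prop where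
  sub : T ⊆ S
  nonempty : T.Nonempty
  rest : ∃ w ∈ S, w ∉ T
  clique : ∀ u ∈ T, ∀ v ∈ T, u ≠ v → u ∈ C → v ∈ C → G.Adj u v
  indep : ∀ u ∈ T, ∀ v ∈ T, u ≠ v → u ∉ C → v ∉ C → ¬ G.Adj u v
  join : ∀ u ∈ T, ∀ w ∈ S, w ∉ T → (G.Adj u w ↔ u ∈ C)

/-- The subgraph induced on `S` is indecomposable. -/
def IndecOn (G : SimpleGraph V) (S : Set V) : Prop := ∀ T C, ¬ IsCut G S T C

/-- The levels `lev = 0, …, k` are the components of a decomposition of the subgraph induced on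
`{v | lev v ≤ k}`; the set `C` collects the clique parts. -/
structure IsLevel (G : SimpleGraph V) (lev : V → ℕ) (C : Set V) (k : ℕ) : Prop where
  nonempty : ∀ i ≤ k, ∃ v, lev v = i
  zero : ∀ v, lev v = 0 → v ∉ C
  clique : ∀ u v, lev u = lev v → lev u ≤ k → u ≠ v → u ∈ C → v ∈ C → G.Adj u v
  indep : ∀ u v, lev u = lev v → lev u ≠ 0 → lev u ≤ k → u ≠ v → u ∉ C → v ∉ C → ¬ G.Adj u v
  join : ∀ u v, lev v < lev u → lev u ≤ k → (G.Adj u v ↔ u ∈ C)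
  indec : ∀ i ≤ k, IndecOn G {v | lev v = i}

theorem IsCut.eq_or_singletons {G : SimpleGraph V} {U T C T' C' : Set V}
    (h : IsCut G U T C) (h' : IsCut G U T' C') (hT : IndecOn G T) (hT' : IndecOn G T') :
    (T = T' ∧ ∀ v ∈ T, (v ∈ C ↔ v ∈ C')) ∨
      ∃ v v', T = {v} ∧ T' = {v'} ∧ v ≠ v' ∧ (v ∈ C ↔ v' ∈ C') := by
  have agree : ∀ v ∈ T, v ∈ T' → (v ∈ C ↔ v ∈ C') := by
    intro v hv hv'
    by_contra hne
    obtain ⟨w, hw, hwT⟩ := h.rest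
    obtain ⟨w', hw', hwT'⟩ := h'.rest
    have h1 := h.join v hv
    have h2 := h'.join v hv'
    have h3 : w ∈ T' := by grind
    have h4 : w' ∈ T := by grind
    have h5 := h.join w' h4 w hw hwT
    have h6 := h'.join w h3 w' hw' hwT'
    have h7 := h.clique v hv w' h4
    have h8 := h.indep v hv w' h4
    have h9 := h'.clique v hv' w h3
    have h10 := h'.indep v hv' w h3
    have h11 := G.adj_comm w w'
    have h12 := h1 w hw hwT
    have h13 := h2 w' hw' hwT'
    have h14 : v ≠ w := by grind
    have h15 : v ≠ w' := by grind
    grind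
  have sub : ∀ {T C T' C' : Set V}, IsCut G U T C → IsCut G U T' C' → IndecOn G T →
      (∀ v ∈ T, v ∈ T' → (v ∈ C ↔ v ∈ C')) → (∃ x ∈ T, x ∈ T') → T ⊆ T' := by
    intro T C T' C' h h' hT agree ⟨x, hx, hx'⟩ y hy
    by_contra hy'
    refine hT (T ∩ T') C ⟨Set.inter_subset_left, ⟨x, hx, hx'⟩, ⟨y, hy, fun h => hy' h.2⟩,
      fun u hu v hv => h.clique u hu.1 v hv.1, fun u hu v hv => h.indep u hu.1 v hv.1, ?_⟩
    intro u hu w hw hwn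
    rw [agree u hu.1 hu.2]
    exact h'.join u hu.2 w (h.sub hw) fun h => hwn ⟨hw, h⟩
  by_cases hx : ∃ x ∈ T, x ∈ T'
  · left
    refine ⟨(sub h h' hT agree hx).antisymm (sub h' h hT' ?_ ?_), fun v hv =>
      agree v hv (sub h h' hT agree hx hv)⟩
    · exact fun v h1 h2 => (agree v h2 h1).symm
    · exact hx.imp fun _ h => h.symm
  · right
    push Not at hx
    have key : ∀ v ∈ T, ∀ v' ∈ T', (v ∈ C ↔ v' ∈ C') := by
      intro v hv v' hv'
      rw [← h.join v hv v' (h'.sub hv') (fun h => hx _ h hv'), G.adj_comm,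
        ← h'.join v' hv' v (h.sub hv) (hx v hv)]
    have single : ∀ {T C : Set V}, IsCut G U T C → IndecOn G T →
        (∀ u ∈ T, ∀ v ∈ T, (u ∈ C ↔ v ∈ C)) → ∀ v ∈ T, T = {v} := by
      intro T C h hT hC v hv
      by_contra hne
      have : ∃ w ∈ T, w ≠ v := by
        by_contra hcon
        push Not at hcon
        exact hne (Set.eq_singleton_iff_unique_mem.2 ⟨hv, hcon⟩)
      obtain ⟨w, hw, hwv⟩ := this
      refine hT {v} C ⟨by simpa using hv, ⟨v, rfl⟩, ⟨w, hw, hwv⟩, by grind, by grind, ?_⟩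
      rintro u rfl x hx hxu
      have h1 := h.clique u hv x hx
      have h2 := h.indep u hv x hx
      have h3 := hC u hv x hx
      have h4 : u ≠ x := fun h => hxu h.symm
      tauto
    obtain ⟨v, hv⟩ := h.nonempty
    obtain ⟨v', hv'⟩ := h'.nonempty
    refine ⟨v, v', single h hT ?_ v hv, single h' hT' ?_ v' hv', ?_, key v hv v' hv'⟩
    · exact fun a ha b hb => (key a ha v' hv').trans (key b hb v' hv').symm
    · exact fun a ha b hb => (key v hv a ha).symm.trans (key v hv b hb)
    · rintro rfl
      exact hx v hv hv'

theorem IsLevel.isCut {G : SimpleGraph V} {lev : V → ℕ} {C : Set V} {k : ℕ}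
    (h : IsLevel G lev C (k + 1)) :
    IsCut G {v | lev v ≤ k + 1} {v | lev v = k + 1} C where
  sub := fun v hv => le_of_eq hv
  nonempty := h.nonempty _ le_rfl
  rest := by
    obtain ⟨v, hv⟩ := h.nonempty 0 (by omega)
    exact ⟨v, by simp [hv], by simp [hv]⟩
  clique := by
    intro u hu v hv
    simp only [Set.mem_ofPred_eq] at hu hv
    exact h.clique u v (by omega) (by omega)
  indep := by
    intro u hu v hv
    simp only [Set.mem_ofPred_eq] at hu hv
    exact h.indep u v (by omega) (by omega) (by omega)
  join := by
    intro u hu v hv hv'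
    simp only [Set.mem_ofPred_eq] at hu hv hv'
    exact h.join u v (by omega) (by omega)

theorem IsLevel.of_succ {G : SimpleGraph V} {lev : V → ℕ} {C : Set V} {k : ℕ}
    (h : IsLevel G lev C (k + 1)) : IsLevel G lev C k where
  nonempty i hi := h.nonempty i (by omega)
  zero := h.zero
  clique u v h1 h2 := h.clique u v h1 (by omega)
  indep u v h1 h2 h3 := h.indep u v h1 h2 (by omega)
  join u v h1 h2 := h.join u v h1 (by omega)
  indec i hi := h.indec i (by omega)

theorem IndecOn.preimage {G : SimpleGraph V} {S : Set V} (τ : Equiv.Perm V) (hS : IndecOn G S)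
    (hτ : ∀ u v, τ u ∈ S → τ v ∈ S → (G.Adj (τ u) (τ v) ↔ G.Adj u v)) :
    IndecOn G (τ ⁻¹' S) := by
  intro T C h
  have adj : ∀ u ∈ S, ∀ v ∈ S, (G.Adj u v ↔ G.Adj (τ.symm u) (τ.symm v)) := by
    intro u hu v hv
    simpa using hτ (τ.symm u) (τ.symm v) (by simpa using hu) (by simpa using hv)
  have sub : ∀ u, τ.symm u ∈ T → u ∈ S := fun u hu => by simpa using h.sub hu
  refine hS (τ.symm ⁻¹' T) (τ.symm ⁻¹' C) ⟨sub, ?_, ?_, ?_, ?_, ?_⟩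
  · obtain ⟨v, hv⟩ := h.nonempty
    exact ⟨τ v, by simpa using hv⟩
  · obtain ⟨w, hw, hwT⟩ := h.rest
    exact ⟨τ w, hw, by simpa using hwT⟩
  · intro u hu v hv huv h1 h2
    rw [adj u (sub u hu) v (sub v hv)]
    exact h.clique _ hu _ hv (by simpa using huv) h1 h2
  · intro u hu v hv huv h1 h2
    rw [adj u (sub u hu) v (sub v hv)]
    exact h.indep _ hu _ hv (by simpa using huv) h1 h2
  · intro u hu w hw hwT
    rw [adj u (sub u hu) w hw]
    exact h.join _ hu _ (by simpa using hw) hwT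

theorem IsLevel.comp_perm {G : SimpleGraph V} {lev : V → ℕ} {C : Set V} {k : ℕ}
    (h : IsLevel G lev C k) (τ : Equiv.Perm V)
    (hτ : ∀ u v, lev (τ u) ≤ k → lev (τ v) ≤ k → (G.Adj (τ u) (τ v) ↔ G.Adj u v)) :
    IsLevel G (lev ∘ τ) (τ ⁻¹' C) k where
  nonempty i hi := by
    obtain ⟨v, hv⟩ := h.nonempty i hi
    exact ⟨τ.symm v, by simpa using hv⟩
  zero v hv := h.zero _ hv
  clique u v h1 h2 h3 h4 h5 := by
    simp only [Function.comp_apply] at h1 h2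
    rw [← hτ u v h2 (h1 ▸ h2)]
    exact h.clique _ _ h1 h2 (by simpa using h3) h4 h5
  indep u v h1 h2 h3 h4 h5 h6 := by
    simp only [Function.comp_apply] at h1 h2 h3
    rw [← hτ u v h3 (h1 ▸ h3)]
    exact h.indep _ _ h1 h2 h3 (by simpa using h4) h5 h6
  join u v h1 h2 := by
    simp only [Function.comp_apply] at h1 h2
    rw [← hτ u v h2 (by omega)]
    exact h.join _ _ h1 h2
  indec i hi := by
    refine (h.indec i hi).preimage τ fun u v hu hv => hτ u v ?_ ?_
    · exact (le_of_eq hu).trans hi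
    · exact (le_of_eq hv).trans hi

theorem IsCut.adj_swap_iff [DecidableEq V] {G : SimpleGraph V} {U C C' : Set V} {x x' : V}
    (h : IsCut G U {x} C) (h' : IsCut G U {x'} C') (hC : x ∈ C ↔ x' ∈ C') {u v : V}
    (hu : u ∈ U) (hv : v ∈ U) :
    G.Adj (Equiv.swap x x' u) (Equiv.swap x x' v) ↔ G.Adj u v := by
  have h1 := h.join x rfl
  have h2 := h'.join x' rfl
  have hx := h.sub rfl
  have hx' := h'.sub rfl
  simp only [Set.mem_singleton_iff] at h1 h2
  have h3 : ∀ w, G.Adj w x ↔ G.Adj x w := fun w => G.adj_comm w x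
  have h4 : ∀ w, G.Adj w x' ↔ G.Adj x' w := fun w => G.adj_comm w x'
  have h5 := G.irrefl (v := x)
  have h6 := G.irrefl (v := x')
  simp only [Equiv.swap_apply_def]
  grind

theorem IsLevel.unique {G : SimpleGraph V} (k : ℕ) : ∀ (k' : ℕ) (lev lev' : V → ℕ) (C C' : Set V),
    IsLevel G lev C k → IsLevel G lev' C' k' → (∀ v, lev v ≤ k ↔ lev' v ≤ k') →
    k = k' ∧ ∃ σ : Equiv.Perm V, (∀ v, ¬ lev v ≤ k → σ v = v) ∧
      (∀ u v, lev u ≤ k → lev v ≤ k → (G.Adj (σ u) (σ v) ↔ G.Adj u v)) ∧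
      (∀ v, lev v ≤ k → lev' (σ v) = lev v ∧ (σ v ∈ C' ↔ v ∈ C)) := by
  classical
  induction k with
  | zero =>
    intro k' lev lev' C C' h h' hU
    cases k' with
    | zero =>
      refine ⟨rfl, 1, fun _ _ => rfl, fun _ _ _ _ => Iff.rfl, fun v hv => ?_⟩
      have h1 := (hU v).1 hv
      have h2 : lev v = 0 := by omega
      have h3 : lev' v = 0 := by omega
      exact ⟨h3.trans h2.symm, iff_of_false (h'.zero v h3) (h.zero v h2)⟩
    | succ k' =>
      have h1 := h'.isCut
      rw [show {v | lev' v ≤ k' + 1} = {v | lev v = 0} by ext v; simp [← hU v]] at h1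
      exact (h.indec 0 le_rfl _ _ h1).elim
  | succ k ih =>
    have top : ∀ (k' : ℕ) (lev lev' : V → ℕ) (C C' : Set V),
        IsLevel G lev C (k + 1) → IsLevel G lev' C' (k' + 1) →
        (∀ v, lev v ≤ k + 1 ↔ lev' v ≤ k' + 1) →
        (∀ v, lev v = k + 1 ↔ lev' v = k' + 1) →
        (∀ v, lev v = k + 1 → (v ∈ C ↔ v ∈ C')) →
        k + 1 = k' + 1 ∧ ∃ σ : Equiv.Perm V, (∀ v, ¬ lev v ≤ k + 1 → σ v = v) ∧
          (∀ u v, lev u ≤ k + 1 → lev v ≤ k + 1 → (G.Adj (σ u) (σ v) ↔ G.Adj u v)) ∧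
          (∀ v, lev v ≤ k + 1 → lev' (σ v) = lev v ∧ (σ v ∈ C' ↔ v ∈ C)) := by
      intro k' lev lev' C C' h h' hU hT hC
      obtain ⟨rfl, σ, hσ, hadj, hlev⟩ := ih k' lev lev' C C' h.of_succ h'.of_succ (by
        intro v
        have h1 := hU v
        have h2 := hT v
        omega)
      have fix : ∀ v, lev v = k + 1 → σ v = v := fun v hv => hσ v (by omega)
      have hle : ∀ v, lev v ≤ k → lev (σ v) ≤ k := by
        intro v hv
        have h1 := (hlev v hv).1
        have h2 := hU (σ v)
        have h3 := hT (σ v)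
        omega
      refine ⟨rfl, σ, fun v hv => hσ v (by omega), ?_, ?_⟩
      · intro u v hu hv
        rcases Nat.lt_or_ge k (lev u) with hu' | hu' <;>
          rcases Nat.lt_or_ge k (lev v) with hv' | hv'
        · rw [hσ u (by omega), hσ v (by omega)]
        · rw [hσ u (by omega), h.join u v (by omega) hu,
            h.join u (σ v) (by have := hle v hv'; omega) hu]
        · rw [hσ v (by omega), G.adj_comm, G.adj_comm u, h.join v u (by omega) hv,
            h.join v (σ u) (by have := hle u hu'; omega) hv]
        · exact hadj u v hu' hv'
      · intro v hv
        rcases Nat.lt_or_ge k (lev v) with hv' | hv'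
        · have hv'' : lev v = k + 1 := by omega
          rw [fix v hv'']
          exact ⟨((hT v).1 hv'').trans hv''.symm, (hC v hv'').symm⟩
        · exact hlev v hv'
    intro k' lev lev' C C' h h' hU
    have hS : {v | lev' v ≤ k'} = {v | lev v ≤ k + 1} := by ext v; simp [hU v]
    cases k' with
    | zero =>
      have h1 := h.isCut
      rw [← hS, show {v | lev' v ≤ 0} = {v | lev' v = 0} by ext v; simp] at h1
      exact (h'.indec 0 le_rfl _ _ h1).elim
    | succ k' =>
      have cut := h.isCut
      have cut' := h'.isCut
      rw [hS] at cut'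
      rcases cut.eq_or_singletons cut' (h.indec _ le_rfl) (h'.indec _ le_rfl) with
        ⟨hT, hC⟩ | ⟨x, x', hx, hx', hne, hC⟩
      · exact top k' lev lev' C C' h h' hU (fun v => Set.ext_iff.1 hT v) hC
      · rw [hx] at cut
        rw [hx'] at cut'
        have hx1 : ∀ v, lev v = k + 1 ↔ v = x := fun v => Set.ext_iff.1 hx v
        have hx2 : ∀ v, lev' v = k' + 1 ↔ v = x' := fun v => Set.ext_iff.1 hx' v
        have hxU : lev x ≤ k + 1 := ((hx1 x).2 rfl).le
        have hxU' : lev x' ≤ k + 1 := (hU x').2 ((hx2 x').2 rfl).le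
        have hswap : ∀ v, lev (Equiv.swap x x' v) ≤ k + 1 ↔ lev v ≤ k + 1 := by
          intro v
          rw [Equiv.swap_apply_def]
          grind
        have hadj : ∀ u v, lev u ≤ k + 1 → lev v ≤ k + 1 →
            (G.Adj (Equiv.swap x x' u) (Equiv.swap x x' v) ↔ G.Adj u v) :=
          fun u v hu hv => cut.adj_swap_iff cut' hC hu hv
        obtain ⟨hk, σ, hσ, hσadj, hσlev⟩ := top k' lev (lev' ∘ Equiv.swap x x') C
          (Equiv.swap x x' ⁻¹' C') h
          (h'.comp_perm _ fun u v hu hv => hadj u v ((hswap u).1 ((hU _).2 hu))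
            ((hswap v).1 ((hU _).2 hv)))
          (fun v => by rw [Function.comp_apply, ← hU, hswap])
          (fun v => by
            rw [Function.comp_apply, hx1, hx2, Equiv.swap_apply_eq_iff, Equiv.swap_apply_right])
          (fun v hv => by
            rw [(hx1 v).1 hv, Set.mem_preimage, Equiv.swap_apply_left]
            exact hC)
        have hσU : ∀ v, lev v ≤ k + 1 → lev (σ v) ≤ k + 1 := by
          intro v hv
          rw [← hswap, hU]
          have := (hσlev v hv).1
          simp only [Function.comp_apply] at this
          omega
        refine ⟨hk, σ.trans (Equiv.swap x x'), ?_, ?_, ?_⟩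
        · intro v hv
          rw [Equiv.trans_apply, hσ v hv, Equiv.swap_apply_of_ne_of_ne]
          · rintro rfl; exact hv hxU
          · rintro rfl; exact hv hxU'
        · intro u v hu hv
          rw [Equiv.trans_apply, Equiv.trans_apply, hadj _ _ (hσU u hu) (hσU v hv),
            hσadj u v hu hv]
        · exact hσlev

/-- A decomposable split graph can be decomposed along any given KS-partition. -/
theorem IsCut.exists_compatible {G : SimpleGraph V} {T T₁ C C₁ : Set V} (h : IsCut G T T₁ C₁)
    (hK : ∀ u ∈ T, ∀ v ∈ T, u ≠ v → u ∈ C → v ∈ C → G.Adj u v)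
    (hI : ∀ u ∈ T, ∀ v ∈ T, u ≠ v → u ∉ C → v ∉ C → ¬ G.Adj u v) :
    ∃ T₂, IsCut G T T₂ C := by
  have mk : ∀ T₂ ⊆ T, T₂.Nonempty → (∃ w ∈ T, w ∉ T₂) →
      (∀ u ∈ T₂, ∀ w ∈ T, w ∉ T₂ → (G.Adj u w ↔ u ∈ C)) → IsCut G T T₂ C :=
    fun T₂ hs hn hr hj => ⟨hs, hn, hr, fun u hu v hv => hK u (hs hu) v (hs hv),
      fun u hu v hv => hI u (hs hu) v (hs hv), hj⟩
  by_cases hagree : ∀ u ∈ T₁, (u ∈ C ↔ u ∈ C₁)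
  · exact ⟨T₁, mk T₁ h.sub h.nonempty h.rest fun u hu w hw hwT =>
      (h.join u hu w hw hwT).trans (hagree u hu).symm⟩
  push Not at hagree
  obtain ⟨u, hu, hne⟩ := hagree
  have hne' : ¬ (u ∈ C ↔ u ∈ C₁) := by grind
  have opp : ∀ t ∈ T, t ∉ T₁ → (t ∈ C ↔ u ∈ C₁) := by
    intro t ht ht'
    have h1 := h.join u hu t ht ht'
    have h2 := hK u (h.sub hu) t ht
    have h3 := hI u (h.sub hu) t ht
    have h4 : u ≠ t := by rintro rfl; exact ht' hu
    grind
  obtain ⟨t, ht, ht'⟩ := h.rest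
  have ht₁ := opp t ht ht'
  have agree : ∀ v ∈ T₁, v ≠ u → (v ∈ C ↔ v ∈ C₁) := by
    intro v hv hvu
    have h1 := h.join v hv t ht ht'
    have h2 := hK v (h.sub hv) t ht
    have h3 := hI v (h.sub hv) t ht
    have h4 : v ≠ t := by rintro rfl; exact ht' hv
    have h5 := hK v (h.sub hv) u (h.sub hu) hvu
    have h6 := hI v (h.sub hv) u (h.sub hu) hvu
    have h7 := h.clique v hv u hu hvu
    have h8 := h.indep v hv u hu hvu
    grind
  by_cases hT₁ : ∃ v ∈ T₁, v ≠ u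
  · obtain ⟨v, hv, hvu⟩ := hT₁
    refine ⟨T₁ \ {u}, mk _ (Set.sdiff_subset.trans h.sub) ⟨v, hv, hvu⟩
      ⟨t, ht, fun h => ht' h.1⟩ ?_⟩
    rintro v ⟨hv, hvu⟩ w hw hwT
    have hvu : v ≠ u := hvu
    by_cases hwu : w = u
    · subst hwu
      have h2 := hK v (h.sub hv) w hw hvu
      have h3 := hI v (h.sub hv) w hw hvu
      have h5 := h.clique v hv w hu hvu
      have h6 := h.indep v hv w hu hvu
      have h7 := agree v hv hvu
      grind
    · rw [agree v hv hvu]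
      exact h.join v hv w hw fun h => hwT ⟨h, hwu⟩
  · push Not at hT₁
    have htu : t ≠ u := by rintro rfl; exact ht' hu
    refine ⟨{t}, mk _ (by simpa using ht) ⟨t, rfl⟩ ⟨u, h.sub hu, htu.symm⟩ ?_⟩
    rintro a rfl w hw hwa
    have hwa : w ≠ a := hwa
    by_cases hwu : w = u
    · subst hwu
      rw [G.adj_comm, h.join w hu a ht ht', ht₁]
    · have h1 := opp w hw fun h => hwu (hT₁ w h)
      have h2 := hK a ht w hw hwa.symm
      have h3 := hI a ht w hw hwa.symm
      grind

theorem exists_isCut_indecOn [Finite V] {G : SimpleGraph V} {U : Set V} (h : ¬ IndecOn G U) :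
    ∃ T C, IsCut G U T C ∧ IndecOn G T := by
  simp only [IndecOn, not_forall, not_not] at h
  obtain ⟨T, hT⟩ := (Set.toFinite {T | ∃ C, IsCut G U T C}).exists_minimal h
  obtain ⟨⟨C, hC⟩, hmin⟩ := hT
  refine ⟨T, C, hC, fun T₁ C₁ h₁ => ?_⟩
  obtain ⟨T₂, h₂⟩ := h₁.exists_compatible hC.clique hC.indep
  obtain ⟨w, hw, hwT⟩ := h₂.rest
  refine hwT (hmin ⟨C, ⟨h₂.sub.trans hC.sub, h₂.nonempty, ⟨w, hC.sub hw, hwT⟩, h₂.clique,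
    h₂.indep, ?_⟩⟩ h₂.sub hw)
  intro u hu x hx hxT
  by_cases hxT' : x ∈ T
  · exact h₂.join u hu x hxT' hxT
  · exact hC.join u (h₂.sub hu) x hx hxT'

theorem exists_isLevel [Finite V] (G : SimpleGraph V) (U : Set V) (hU : U.Nonempty) :
    ∃ k lev C, IsLevel G lev C k ∧ ∀ v, lev v ≤ k ↔ v ∈ U := by
  classical
  induction U using WellFoundedLT.induction with
  | ind U ih =>
  by_cases hind : IndecOn G U
  · refine ⟨0, fun v => if v ∈ U then 0 else 1, ∅, ⟨?_, ?_, ?_, ?_, ?_, ?_⟩, ?_⟩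
    · intro i hi
      obtain ⟨v, hv⟩ := hU
      exact ⟨v, by simp [hv]; omega⟩
    · simp
    · simp
    · intro u v _ h1 h2
      omega
    · intro u v h1 h2
      omega
    · intro i hi
      convert hind using 1
      ext v
      by_cases hv : v ∈ U <;> simp [hv] <;> omega
    · intro v
      by_cases hv : v ∈ U <;> simp [hv]
  · obtain ⟨T, C, hT, hTind⟩ := exists_isCut_indecOn hind
    have hsub : U \ T ⊂ U := by
      obtain ⟨x, hx⟩ := hT.nonempty
      exact ⟨Set.sdiff_subset, fun h => (h (hT.sub hx)).2 hx⟩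
    obtain ⟨w, hw, hwT⟩ := hT.rest
    obtain ⟨k, lev, D, h, hlev⟩ := ih (U \ T) hsub ⟨w, hw, hwT⟩
    have hTlev : ∀ v ∈ T, k < lev v := fun v hv => by
      by_contra hcon
      exact ((hlev v).1 (by omega)).2 hv
    let lev' : V → ℕ := fun v => if v ∈ T then k + 1 else if lev v ≤ k then lev v else k + 2
    have cases : ∀ v, (v ∈ T ∧ lev' v = k + 1) ∨ (v ∉ T ∧ v ∈ U ∧ lev v ≤ k ∧ lev' v = lev v) ∨
        (v ∉ T ∧ v ∉ U ∧ k < lev v ∧ lev' v = k + 2) := by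
      intro v
      have := hlev v
      simp only [Set.mem_sdiff] at this
      grind
    have hCT : ∀ v ∈ T, (v ∈ T ∩ C ∪ D \ T ↔ v ∈ C) := fun v hv => by simp [hv]
    have hDT : ∀ v ∉ T, (v ∈ T ∩ C ∪ D \ T ↔ v ∈ D) := fun v hv => by simp [hv]
    refine ⟨k + 1, lev', T ∩ C ∪ D \ T, ⟨?_, ?_, ?_, ?_, ?_, ?_⟩, ?_⟩
    · intro i hi
      rcases Nat.lt_or_ge k i with hki | hki
      · obtain ⟨x, hx⟩ := hT.nonempty
        exact ⟨x, by have := cases x; grind⟩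
      · obtain ⟨v, hv⟩ := h.nonempty i hki
        have := hTlev v
        exact ⟨v, by have := cases v; grind⟩
    · intro v hv
      have hvT : v ∉ T := by have := cases v; grind
      rw [hDT v hvT]
      refine h.zero v ?_
      have := cases v
      grind
    · intro u v huv hu hne hu' hv'
      rcases cases u with ⟨h1, h2⟩ | ⟨h1, -, h2, h3⟩ | h1
      · have h4 : v ∈ T := by have := cases v; grind
        exact hT.clique u h1 v h4 hne ((hCT u h1).1 hu') ((hCT v h4).1 hv')
      · have h4 : v ∉ T ∧ lev u = lev v := by have := cases v; grind
        exact h.clique u v h4.2 h2 hne ((hDT u h1).1 hu') ((hDT v h4.1).1 hv')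
      · omega
    · intro u v huv h0 hu hne hu' hv'
      rcases cases u with ⟨h1, h2⟩ | ⟨h1, -, h2, h3⟩ | h1
      · have h4 : v ∈ T := by have := cases v; grind
        exact hT.indep u h1 v h4 hne (mt (hCT u h1).2 hu') (mt (hCT v h4).2 hv')
      · have h4 : v ∉ T ∧ lev u = lev v := by have := cases v; grind
        exact h.indep u v h4.2 (by omega) h2 hne (mt (hDT u h1).2 hu') (mt (hDT v h4.1).2 hv')
      · omega
    · intro u v huv hu
      rcases cases u with ⟨h1, h2⟩ | ⟨h1, -, h2, h3⟩ | h1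
      · have h4 : v ∈ U ∧ v ∉ T := by have := cases v; grind
        rw [hCT u h1, hT.join u h1 v h4.1 h4.2]
      · have h4 : lev v < lev u := by have := cases v; grind
        rw [hDT u h1, h.join u v h4 h2]
      · omega
    · intro i hi
      rcases Nat.lt_or_ge k i with hki | hki
      · convert hTind using 1
        ext v
        have := cases v
        simp only [Set.mem_ofPred_eq]
        grind
      · convert h.indec i hki using 1
        ext v
        have := cases v
        have := hTlev v
        simp only [Set.mem_ofPred_eq]
        grind
    · intro v
      have := cases v
      have := @hT.sub v
      grind

theorem iterComp_adj_same {k : ℕ} {Vi : Fin (k + 1) → Type} (Gi : ∀ i, SimpleGraph (Vi i))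
    (A : ∀ i, Set (Vi i)) (i : Fin (k + 1)) (x y : Vi i) :
    (iterComp Gi A).Adj ⟨i, x⟩ ⟨i, y⟩ ↔ (Gi i).Adj x y := by
  simp only [iterComp, SimpleGraph.fromRel_adj, exists_true_left, lt_irrefl, false_and, or_false,
    (Gi i).adj_comm y x, or_self, ne_eq, Sigma.mk.injEq, heq_eq_eq, true_and]
  exact ⟨fun h => h.2, fun h => ⟨h.ne, h⟩⟩

theorem iterComp_adj_of_lt {k : ℕ} {Vi : Fin (k + 1) → Type} (Gi : ∀ i, SimpleGraph (Vi i))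
    (A : ∀ i, Set (Vi i)) {p q : Σ i, Vi i} (h : q.1 < p.1) :
    (iterComp Gi A).Adj p q ↔ p.2 ∈ A p.1 := by
  have hne : p ≠ q := by rintro rfl; exact lt_irrefl _ h
  simp [iterComp, SimpleGraph.fromRel_adj, h.ne, h.ne', h, h.not_gt, hne]

theorem IndecOn.not_decomposable_induce {G : SimpleGraph V} {S : Set V} (h : IndecOn G S) :
    ¬ Decomposable (G.induce S) := by
  rintro ⟨A, B, W, hU, hAB, hW, hne, hWne, hA, hB, hAW, hBW⟩
  have hcov : ∀ x : S, x ∈ A ∨ x ∈ B ∨ x ∈ W := fun x => by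
    have : x ∈ A ∪ B ∪ W := hU ▸ Set.mem_univ x
    simpa [or_assoc] using this
  have hAB' : ∀ x ∈ A, x ∉ B := fun x hx => Set.disjoint_left.1 hAB hx
  have hW' : ∀ x ∈ A ∪ B, x ∉ W := fun x hx => Set.disjoint_left.1 hW hx
  have hmem : ∀ (D : Set S) (x : S), x.1 ∈ Subtype.val '' D ↔ x ∈ D := fun D x =>
    Subtype.val_injective.mem_set_image
  refine h (Subtype.val '' (A ∪ B)) (Subtype.val '' A) ⟨?_, hne.image _, ?_, ?_, ?_, ?_⟩
  · rintro _ ⟨x, -, rfl⟩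
    exact x.2
  · obtain ⟨w, hw⟩ := hWne
    exact ⟨w, w.2, fun h => hW' w ((hmem _ w).1 h) hw⟩
  · rintro _ ⟨x, -, rfl⟩ _ ⟨y, -, rfl⟩ hxy hx hy
    exact hA ((hmem _ x).1 hx) ((hmem _ y).1 hy) fun h => hxy (congrArg _ h)
  · rintro _ ⟨x, hx', rfl⟩ _ ⟨y, hy', rfl⟩ hxy hx hy
    rw [hmem] at hx hy
    exact hB (hx'.resolve_left hx) (hy'.resolve_left hy) fun h => hxy (congrArg _ h)
  · rintro _ ⟨x, hx, rfl⟩ w hw hwT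
    have hwW : (⟨w, hw⟩ : S) ∈ W := by
      have h1 := hcov ⟨w, hw⟩
      have h2 := mt (hmem (A ∪ B) ⟨w, hw⟩).2 hwT
      simp only [Set.mem_union] at h2
      tauto
    rw [hmem]
    refine ⟨fun hadj => hx.resolve_right fun hxB => hBW x hxB _ hwW hadj, fun hxA => ?_⟩
    exact hAW x hxA _ hwW

theorem indecOn_range_of_not_decomposable {W : Type} {G : SimpleGraph V} {H : SimpleGraph W}
    (f : H ↪g G) (h : ¬ Decomposable H) : IndecOn G (Set.range f) := by
  intro T C hT
  refine h ⟨f ⁻¹' (T ∩ C), f ⁻¹' (T \ C), f ⁻¹' Tᶜ, ?_, ?_, ?_, ?_, ?_, ?_, ?_, ?_, ?_⟩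
  · ext x
    simp only [Set.mem_union, Set.mem_preimage, Set.mem_inter_iff, Set.mem_sdiff, Set.mem_compl_iff,
      Set.mem_univ, iff_true]
    tauto
  · exact Set.disjoint_left.2 fun x h1 h2 => h2.2 h1.2
  · exact Set.disjoint_left.2 fun x h1 h2 => h2 (h1.elim (fun h => h.1) fun h => h.1)
  · obtain ⟨v, hv⟩ := hT.nonempty
    obtain ⟨x, rfl⟩ := hT.sub hv
    exact ⟨x, by by_cases hx : f x ∈ C <;> simp [hv]⟩
  · obtain ⟨_, ⟨x, rfl⟩, hx⟩ := hT.rest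
    exact ⟨x, hx⟩
  · intro x hx y hy hxy
    exact f.map_adj_iff.1 (hT.clique _ hx.1 _ hy.1 (f.injective.ne hxy) hx.2 hy.2)
  · intro x hx y hy hxy
    rw [← f.map_adj_iff]
    exact hT.indep _ hx.1 _ hy.1 (f.injective.ne hxy) hx.2 hy.2
  · intro x hx y hy
    exact f.map_adj_iff.1 ((hT.join _ hx.1 _ ⟨y, rfl⟩ hy).2 hx.2)
  · intro x hx y hy hadj
    exact hx.2 ((hT.join _ hx.1 _ ⟨y, rfl⟩ hy).1 (f.map_adj_iff.2 hadj))

namespace CanonDecomp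

variable [Fintype V] {G : SimpleGraph V}

/-- The index of the component containing a vertex. -/
def level (D : CanonDecomp G) (v : V) : ℕ := (D.iso v).1

/-- The vertices in the clique part of their component. -/
def cliquePart (D : CanonDecomp G) : Set V := {v | (D.iso v).2 ∈ D.A (D.iso v).1}

/-- A component of a decomposition, embedded in the whole graph. -/
def emb (D : CanonDecomp G) (i : Fin (D.k + 1)) : D.Gi i ↪g G where
  toFun x := D.iso.symm ⟨i, x⟩
  inj' x y h := by simpa using h
  map_rel_iff' {x y} := by
    rw [← iterComp_adj_same D.Gi D.A i x y]
    exact D.iso.symm.map_adj_iff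

theorem iso_emb (D : CanonDecomp G) (i : Fin (D.k + 1)) (x : D.Vi i) :
    D.iso (D.emb i x) = ⟨i, x⟩ := D.iso.apply_symm_apply _

theorem level_emb (D : CanonDecomp G) (i : Fin (D.k + 1)) (x : D.Vi i) :
    D.level (D.emb i x) = i := by
  rw [level, D.iso_emb]

theorem emb_mem_cliquePart (D : CanonDecomp G) (i : Fin (D.k + 1)) (x : D.Vi i) :
    D.emb i x ∈ D.cliquePart ↔ x ∈ D.A i := by
  rw [cliquePart, Set.mem_ofPred_eq, D.iso_emb]

theorem level_le (D : CanonDecomp G) (v : V) : D.level v ≤ D.k :=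
  Nat.lt_succ_iff.1 (D.iso v).1.2

theorem exists_emb_eq (D : CanonDecomp G) {i : Fin (D.k + 1)} {v : V} (h : D.level v = i) :
    ∃ x, D.emb i x = v := by
  obtain rfl : (D.iso v).1 = i := Fin.ext h
  exact ⟨(D.iso v).2, D.iso.symm_apply_apply v⟩

theorem isLevel (D : CanonDecomp G) : IsLevel G D.level D.cliquePart D.k := by
  have rep : ∀ v, ∃ (i : Fin (D.k + 1)) (x : D.Vi i), D.emb i x = v := fun v =>
    ⟨_, D.exists_emb_eq (i := (D.iso v).1) rfl⟩
  refine ⟨?_, ?_, ?_, ?_, ?_, ?_⟩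
  · intro i hi
    obtain ⟨x⟩ := D.nonemp ⟨i, Nat.lt_succ_iff.2 hi⟩
    exact ⟨D.emb _ x, D.level_emb _ x⟩
  · intro v hv
    obtain ⟨x, rfl⟩ := D.exists_emb_eq (i := 0) hv
    simp [D.emb_mem_cliquePart, D.hA0]
  · intro u v huv _ hne hu hv
    obtain ⟨i, x, rfl⟩ := rep u
    rw [D.level_emb] at huv
    obtain ⟨y, rfl⟩ := D.exists_emb_eq huv.symm
    rw [emb_mem_cliquePart] at hu hv
    rw [Embedding.map_adj_iff]
    have hi : i ≠ 0 := by rintro rfl; simp [D.hA0] at hu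
    exact (D.ksp i hi).1 hu hv fun h => hne (congrArg _ h)
  · intro u v huv h0 _ hne hu hv
    obtain ⟨i, x, rfl⟩ := rep u
    rw [D.level_emb] at huv h0
    obtain ⟨y, rfl⟩ := D.exists_emb_eq huv.symm
    rw [emb_mem_cliquePart] at hu hv
    rw [Embedding.map_adj_iff]
    have hi : i ≠ 0 := by rintro rfl; simp at h0
    obtain ⟨-, hB, hAB, -⟩ := D.ksp i hi
    have hmem : ∀ z, z ∉ D.A i → z ∈ D.B i := fun z hz =>
      (hAB ▸ Set.mem_univ z : z ∈ D.A i ∪ D.B i).resolve_left hz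
    exact hB (hmem x hu) (hmem y hv) fun h => hne (congrArg _ h)
  · intro u v huv _
    rw [← D.iso.map_adj_iff]
    exact iterComp_adj_of_lt D.Gi D.A huv
  · intro i hi
    have := indecOn_range_of_not_decomposable (D.emb ⟨i, Nat.lt_succ_iff.2 hi⟩) (D.indec _)
    convert this using 1
    ext v
    constructor
    · exact fun hv => D.exists_emb_eq hv
    · rintro ⟨x, rfl⟩
      exact D.level_emb _ x

theorem mem_B_iff (D : CanonDecomp G) (i : Fin (D.k + 1)) (x : D.Vi i) :
    x ∈ D.B i ↔ i ≠ 0 ∧ x ∉ D.A i := by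
  by_cases hi : i = 0
  · subst hi
    simp [D.hB0]
  · obtain ⟨-, -, hAB, hd⟩ := D.ksp i hi
    refine ⟨fun h => ⟨hi, fun h' => Set.disjoint_left.1 hd h' h⟩, fun h => ?_⟩
    exact (hAB ▸ Set.mem_univ x : x ∈ D.A i ∪ D.B i).resolve_left h.2

end CanonDecomp

theorem IsLevel.nonempty_canonDecomp [Fintype V] {G : SimpleGraph V} {lev : V → ℕ} {C : Set V}
    {k : ℕ} (h : IsLevel G lev C k) (hk : ∀ v, lev v ≤ k) : Nonempty (CanonDecomp G) := by
  classical
  let Gi : ∀ i : Fin (k + 1), SimpleGraph {v | lev v = i} := fun i => G.induce _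
  let A : ∀ i : Fin (k + 1), Set {v | lev v = i} := fun i => {x | x.1 ∈ C}
  let e : V ≃ Σ i : Fin (k + 1), {v | lev v = i} :=
    { toFun := fun v => ⟨⟨lev v, Nat.lt_succ_iff.2 (hk v)⟩, ⟨v, rfl⟩⟩
      invFun := fun p => p.2.1
      left_inv := fun v => rfl
      right_inv := by
        rintro ⟨⟨i, hi⟩, ⟨v, hv⟩⟩
        obtain rfl : lev v = i := hv
        rfl }
  have he : ∀ p q, G.Adj (e.symm p) (e.symm q) ↔ (iterComp Gi A).Adj p q := by
    rintro ⟨i, x⟩ ⟨j, y⟩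
    change G.Adj x.1 y.1 ↔ _
    have hx : lev x.1 = i := x.2
    have hy : lev y.1 = j := y.2
    rcases lt_trichotomy i j with hij | rfl | hij
    · rw [SimpleGraph.adj_comm, (iterComp Gi A).adj_comm, iterComp_adj_of_lt Gi A hij,
        h.join _ _ (by simpa [hx, hy] using hij) (hk _)]
      rfl
    · rw [iterComp_adj_same]
      rfl
    · rw [iterComp_adj_of_lt Gi A hij, h.join _ _ (by simpa [hx, hy] using hij) (hk _)]
      rfl
  refine ⟨{
    k := k
    Vi := fun i => {v | lev v = i}
    fin := fun i => inferInstance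
    nonemp := fun i => (h.nonempty i (Nat.lt_succ_iff.1 i.2)).elim fun v hv => ⟨⟨v, hv⟩⟩
    Gi := Gi
    A := A
    B := fun i => {x | i ≠ 0 ∧ x.1 ∉ C}
    ksp := ?_
    hA0 := Set.eq_empty_of_forall_notMem fun x hx => h.zero x.1 x.2 hx
    hB0 := Set.eq_empty_of_forall_notMem fun x hx => hx.1 rfl
    indec := fun i => (h.indec i (Nat.lt_succ_iff.1 i.2)).not_decomposable_induce
    iso := ⟨e, fun {u v} => (he (e u) (e v)).symm.trans (by simp)⟩ }⟩
  intro i hi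
  have hlev : ∀ x : {v | lev v = i}, lev x.1 = i := fun x => x.2
  refine ⟨?_, ?_, ?_, ?_⟩
  · intro x hx y hy hxy
    exact h.clique x.1 y.1 ((hlev x).trans (hlev y).symm) (hk _) (fun h => hxy (Subtype.ext h))
      hx hy
  · intro x hx y hy hxy
    exact h.indep x.1 y.1 ((hlev x).trans (hlev y).symm)
      (by rw [hlev x]; exact fun h => hi (Fin.ext h)) (hk _) (fun h => hxy (Subtype.ext h))
      hx.2 hy.2
  · ext x
    simp only [A, Set.mem_union, Set.mem_ofPred_eq, Set.mem_univ, iff_true]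
    tauto
  · exact Set.disjoint_left.2 fun x hx hx' => hx'.2 hx

/-- An automorphism of `G` respecting levels and clique parts restricts to the components. -/
theorem CanonDecomp.exists_component_iso [Fintype V] {G : SimpleGraph V} (D₁ D₂ : CanonDecomp G)
    (σ : Equiv.Perm V) (hadj : ∀ u v, G.Adj (σ u) (σ v) ↔ G.Adj u v)
    (hlev : ∀ v, D₂.level (σ v) = D₁.level v)
    (hC : ∀ v, σ v ∈ D₂.cliquePart ↔ v ∈ D₁.cliquePart)
    (i : Fin (D₁.k + 1)) (j : Fin (D₂.k + 1)) (hij : (i : ℕ) = j) :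
    ∃ e : D₁.Gi i ≃g D₂.Gi j, ⇑e '' D₁.A i = D₂.A j ∧ ⇑e '' D₁.B i = D₂.B j := by
  have hex : ∀ x : D₁.Vi i, ∃ y : D₂.Vi j, D₂.emb j y = σ (D₁.emb i x) := fun x =>
    D₂.exists_emb_eq (by rw [hlev, D₁.level_emb, hij])
  choose f hf using hex
  have hinj : Function.Injective f := by
    intro x y hxy
    have := hf x
    rw [hxy, hf y] at this
    exact ((D₁.emb i).injective (σ.injective this)).symm
  have hsurj : Function.Surjective f := by
    intro y
    obtain ⟨x, hx⟩ := D₁.exists_emb_eq (i := i) (v := σ.symm (D₂.emb j y))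
      (by rw [← hlev, σ.apply_symm_apply, D₂.level_emb, hij])
    refine ⟨x, (D₂.emb j).injective ?_⟩
    rw [hf, hx, σ.apply_symm_apply]
  have hA : ∀ x, f x ∈ D₂.A j ↔ x ∈ D₁.A i := by
    intro x
    rw [← D₂.emb_mem_cliquePart, hf, hC, D₁.emb_mem_cliquePart]
  have hB : ∀ x, f x ∈ D₂.B j ↔ x ∈ D₁.B i := by
    intro x
    rw [D₂.mem_B_iff, D₁.mem_B_iff, hA, ne_eq, ne_eq, Fin.ext_iff, Fin.ext_iff, hij]
    rfl
  refine ⟨⟨Equiv.ofBijective f ⟨hinj, hsurj⟩, fun {x y} => ?_⟩, ?_, ?_⟩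
  · change (D₂.Gi j).Adj (f x) (f y) ↔ _
    rw [← (D₂.emb j).map_adj_iff, hf, hf, hadj, (D₁.emb i).map_adj_iff]
  · change f '' D₁.A i = D₂.A j
    rw [← Set.image_preimage_eq (D₂.A j) hsurj]
    exact congrArg _ (Set.ext fun x => (hA x).symm)
  · change f '' D₁.B i = D₂.B j
    rw [← Set.image_preimage_eq (D₂.B j) hsurj]
    exact congrArg _ (Set.ext fun x => (hB x).symm)

/-- **The Canonical Decomposition Theorem of Tyshkevich.** Every finite graph admits a
decomposition into indecomposable components, and it is canonical: two such
decompositions have the same length and componentwise isomorphic pieces, via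
isomorphisms carrying the chosen clique parts onto each other and the chosen stable
parts onto each other. -/
theorem canonical_decomposition {V : Type} [Fintype V] [Nonempty V] (G : SimpleGraph V) :
    Nonempty (CanonDecomp G) ∧
    ∀ D₁ D₂ : CanonDecomp G, ∃ h : D₁.k = D₂.k,
      ∀ i : Fin (D₁.k + 1),
        ∃ e : D₁.Gi i ≃g D₂.Gi (Fin.cast (by rw [h]) i),
          ⇑e '' D₁.A i = D₂.A (Fin.cast (by rw [h]) i) ∧
          ⇑e '' D₁.B i = D₂.B (Fin.cast (by rw [h]) i) := by
  constructor
  · obtain ⟨k, lev, C, h, hk⟩ := exists_isLevel G Set.univ Set.univ_nonempty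
    exact h.nonempty_canonDecomp fun v => (hk v).2 (Set.mem_univ v)
  · intro D₁ D₂
    obtain ⟨hk, σ, -, hadj, hσ⟩ := IsLevel.unique D₁.k D₂.k _ _ _ _ D₁.isLevel D₂.isLevel
      fun v => iff_of_true (D₁.level_le v) (D₂.level_le v)
    refine ⟨hk, fun i => D₁.exists_component_iso D₂ σ ?_ ?_ ?_ i _ rfl⟩
    · exact fun u v => hadj u v (D₁.level_le u) (D₁.level_le v)
    · exact fun v => (hσ v (D₁.level_le v)).1
    · exact fun v => (hσ v (D₁.level_le v)).2

end Tysh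
end

section
/- Let G be a finite simple graph with canonical decomposition G ≅ (G_k,A_k,B_k) ∘ ⋯ ∘ (G_1,A_1,B_1) ∘ G_0 into indecomposable components, where each (G_i,A_i,B_i) for i ≥ 1 is an indecomposable split graph and G_0 is an indecomposable graph. Then G is a unigraph if and only if G_i is a unigraph for every i = 0, 1, …, k. -/
namespace Tysh

open SimpleGraph

variable {V : Type}

section Decomposability

variable {G : SimpleGraph V} {A B : Set V} {v : V}

lemma IsKSPartition.mem_right (h : IsKSPartition G A B) : v ∈ B ↔ v ∉ A := by
  refine ⟨fun hB hA => Set.disjoint_left.1 h.2.2.2 hA hB, fun hA => ?_⟩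
  have : v ∈ A ∪ B := h.2.2.1 ▸ Set.mem_univ v
  exact this.resolve_left hA

variable [Nontrivial V]

lemma decomposable_of_dominating (h : ∀ u, u ≠ v → G.Adj v u) : Decomposable G := by
  obtain ⟨u, hu⟩ := exists_ne v
  exact ⟨{v}, ∅, {v}ᶜ, by simp, by simp, by simp, by simp, ⟨u, hu⟩, by simp,
    by simp [IsIndep], by simpa using h, by simp⟩

lemma decomposable_of_isolated (h : ∀ u, u ≠ v → ¬ G.Adj v u) : Decomposable G := by
  obtain ⟨u, hu⟩ := exists_ne v
  exact ⟨∅, {v}, {v}ᶜ, by simp, by simp, by simp, by simp, ⟨u, hu⟩, by simp,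
    by simp +contextual [IsIndep], by simp, by simpa using h⟩

lemma IsKSPartition.decomposable_of_mem_left (h : IsKSPartition G A B) (hv : v ∈ A)
    (hB : ∀ b ∈ B, ¬ G.Adj v b) : Decomposable G := by
  obtain ⟨u, hu⟩ := exists_ne v
  refine ⟨A \ {v}, B, {v}, ?_, h.2.2.2.mono_left Set.sdiff_subset, ?_, ⟨u, ?_⟩, by simp,
    h.1.subset Set.sdiff_subset, h.2.1, ?_, ?_⟩
  · ext x
    by_cases hx : x ∈ A <;> simp [h.mem_right, hx, em]
  · simp [h.mem_right, hv]
  · by_cases hx : u ∈ A <;> simp [h.mem_right, hx, hu]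
  · rintro a ⟨ha, hav⟩ w rfl
    exact h.1 ha hv hav
  · rintro b hb w rfl
    exact fun hab => hB b hb hab.symm

lemma IsKSPartition.decomposable_of_mem_right (h : IsKSPartition G A B) (hv : v ∈ B)
    (hA : ∀ a ∈ A, G.Adj v a) : Decomposable G := by
  obtain ⟨u, hu⟩ := exists_ne v
  have hvA := h.mem_right.1 hv
  refine ⟨A, B \ {v}, {v}, ?_, h.2.2.2.mono_right Set.sdiff_subset, ?_, ⟨u, ?_⟩, by simp,
    h.1, fun x hx y hy => h.2.1 hx.1 hy.1, ?_, ?_⟩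
  · ext x
    by_cases hx : x ∈ A <;> simp [h.mem_right, hx, em]
  · simp [hvA]
  · by_cases hx : u ∈ A <;> simp [h.mem_right, hx, hu]
  · rintro a ha w rfl
    exact (hA a ha).symm
  · rintro b ⟨hb, hbv⟩ w rfl
    exact h.2.1 hb hv hbv

end Decomposability

/-- An indecomposable split graph has at most one KS-partition with a given clique size. -/
lemma IsKSPartition.eq_of_ncard_eq [Finite V] {G : SimpleGraph V} {A B A' B' : Set V}
    (h : IsKSPartition G A B) (h' : IsKSPartition G A' B') (hG : ¬ Decomposable G)
    (hcard : A.ncard = A'.ncard) : A = A' := by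
  by_contra hne
  obtain ⟨x, hxA, hxA'⟩ : ∃ x ∈ A, x ∉ A' := by
    by_contra! hsub
    exact hne (Set.eq_of_subset_of_ncard_le hsub hcard.ge)
  obtain ⟨y, hyA', hyA⟩ : ∃ y ∈ A', y ∉ A := by
    by_contra! hsub
    exact hne (Set.eq_of_subset_of_ncard_le hsub hcard.le).symm
  have hxy : x ≠ y := fun e => hyA (e ▸ hxA)
  have : Nontrivial V := ⟨x, y, hxy⟩
  have hA : ∀ a ∈ A, a ≠ x → a ∈ A' := fun a ha hax => by
    by_contra haA'
    exact h'.2.1 (h'.mem_right.2 haA') (h'.mem_right.2 hxA') hax (h.1 ha hxA hax)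
  have hB : ∀ b ∈ B, b ≠ y → b ∈ B' := fun b hb hby => by
    by_contra hbB'
    exact h.2.1 hb (h.mem_right.2 hyA) hby
      (h'.1 (not_not.1 (mt h'.mem_right.2 hbB')) hyA' hby)
  by_cases hadj : G.Adj y x
  · refine hG (h.decomposable_of_mem_right (h.mem_right.2 hyA) fun a ha => ?_)
    by_cases hax : a = x
    · exact hax ▸ hadj
    · exact h'.1 hyA' (hA a ha hax) (fun e => hyA (e ▸ ha))
  · refine hG (h.decomposable_of_mem_left hxA fun b hb => ?_)
    by_cases hby : b = y
    · exact hby ▸ fun hxb => hadj hxb.symm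
    · exact h'.2.1 (h'.mem_right.2 hxA') (hB b hb hby) (fun e => h.mem_right.1 hb (e ▸ hxA))

section Degree

variable {W : Type}

lemma ncard_neighborSet_iso {G : SimpleGraph V} {H : SimpleGraph W} (e : G ≃g H) (v : V) :
    (H.neighborSet (e v)).ncard = (G.neighborSet v).ncard := by
  rw [← Set.ncard_image_of_injective _ e.injective]
  congr 1
  ext w
  obtain ⟨u, rfl⟩ := e.surjective w
  simp [e.map_adj_iff]

variable [Fintype V] [Fintype W]

lemma degMultiset_eq_of_iso {G : SimpleGraph V} {H : SimpleGraph W} (e : G ≃g H) :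
    degMultiset G = degMultiset H := by
  unfold degMultiset
  rw [← Multiset.map_univ_val_equiv e.toEquiv, Multiset.map_map]
  exact Multiset.map_congr rfl fun v _ => (ncard_neighborSet_iso e v).symm

lemma exists_equiv_of_map_univ_eq {α : Type} [DecidableEq α] {f : V → α} {g : W → α}
    (h : Finset.univ.val.map f = Finset.univ.val.map g) : ∃ e : V ≃ W, ∀ v, g (e v) = f v := by
  have hfib : ∀ a, Nonempty ({v // f v = a} ≃ {w // g w = a}) := fun a => by
    have hc := congrArg (Multiset.count a) h
    rw [Multiset.count_map, Multiset.count_map] at hc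
    refine Fintype.card_eq.1 ?_
    rw [Fintype.card_subtype, Fintype.card_subtype]
    simpa only [eq_comm, Finset.card, Finset.filter_val] using hc
  exact ⟨(Equiv.sigmaFiberEquiv f).symm.trans
    ((Equiv.sigmaCongrRight fun a => (hfib a).some).trans (Equiv.sigmaFiberEquiv g)),
    fun v => ((hfib (f v)).some ⟨v, rfl⟩).2⟩

/-- A unigraph is determined among graphs on its own vertex set by its degree function. -/
lemma unigraph_iff {G : SimpleGraph V} : Unigraph G ↔ ∀ H : SimpleGraph V,
    (∀ v, (H.neighborSet v).ncard = (G.neighborSet v).ncard) → Nonempty (G ≃g H) := by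
  refine ⟨fun h H hH => h V H (Multiset.map_congr rfl fun v _ => (hH v).symm),
    fun h W _ H hH => ?_⟩
  obtain ⟨e, he⟩ := exists_equiv_of_map_univ_eq hH
  obtain ⟨φ⟩ := h (H.comap e) fun v => by
    rw [← he v, ← ncard_neighborSet_iso (Iso.comap e H)]
    rfl
  exact ⟨φ.trans (Iso.comap e H)⟩

lemma Unigraph.of_iso {G : SimpleGraph V} {H : SimpleGraph W} (e : G ≃g H) (h : Unigraph G) :
    Unigraph H := fun U _ K hK => by
  obtain ⟨φ⟩ := h U K ((degMultiset_eq_of_iso e).trans hK)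
  exact ⟨e.symm.trans φ⟩

/-- Adjacency is forced by the sign of the sum of the weights of the end vertices, whenever that
sum is nonzero. -/
def WeightCompatible (w : V → ℤ) (G : SimpleGraph V) : Prop :=
  ∀ u v, u ≠ v → (0 < w u + w v → G.Adj u v) ∧ (w u + w v < 0 → ¬ G.Adj u v)

lemma sum_weight_mul_degree (w : V → ℤ) (G : SimpleGraph V) [DecidableRel G.Adj] :
    ∑ u, ∑ v, (w u + w v) * (if G.Adj u v then 1 else 0) =
      2 * ∑ u, w u * (G.neighborSet u).ncard := by
  have h : ∑ u, ∑ v, w u * (if G.Adj u v then 1 else 0) =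
      ∑ u, w u * (G.neighborSet u).ncard := by
    refine Finset.sum_congr rfl fun u _ => ?_
    rw [← Finset.mul_sum, Set.ncard_eq_toFinset_card', Finset.sum_boole]
    congr 3
    ext
    simp
  have h' : ∑ u, ∑ v, w v * (if G.Adj u v then 1 else 0) =
      ∑ u, w u * (G.neighborSet u).ncard := by
    rw [Finset.sum_comm, ← h]
    simp only [G.adj_comm]
  simp only [add_mul, Finset.sum_add_distrib, h, h']
  ring

/-- Weight compatibility depends only on the degree function, since compatible graphs are those
maximizing the weighted degree sum. -/
lemma WeightCompatible.of_degree_eq {w : V → ℤ} {G H : SimpleGraph V} (h : WeightCompatible w G)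
    (hdeg : ∀ v, (H.neighborSet v).ncard = (G.neighborSet v).ncard) : WeightCompatible w H := by
  classical
  let f : V → V → ℤ := fun u v =>
    (w u + w v) * (if G.Adj u v then 1 else 0) - (w u + w v) * (if H.Adj u v then 1 else 0)
  have hf : ∀ u v, 0 ≤ f u v := fun u v => by
    by_cases huv : u = v
    · simp [f, huv]
    · have := h u v huv
      grind
  have hsum : ∑ u, ∑ v, f u v = 0 := by
    simp only [f, Finset.sum_sub_distrib, sum_weight_mul_degree, hdeg, sub_self]
  intro u v huv
  have h1 := (Finset.sum_eq_zero_iff_of_nonneg fun u _ =>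
    Finset.sum_nonneg fun v _ => hf u v).1 hsum u (Finset.mem_univ u)
  have h2 : f u v = 0 := (Finset.sum_eq_zero_iff_of_nonneg fun v _ => hf u v).1 h1 v
    (Finset.mem_univ v)
  have := h u v huv
  grind

end Degree

section IterComp

variable {k : ℕ} {Vi : Fin (k + 1) → Type} {Gi Hi : ∀ i, SimpleGraph (Vi i)}
  {A B : ∀ i, Set (Vi i)}

lemma iterComp_adj_mk {i : Fin (k + 1)} {x y : Vi i} :
    (iterComp Gi A).Adj ⟨i, x⟩ ⟨i, y⟩ ↔ (Gi i).Adj x y := by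
  simp only [iterComp, fromRel_adj, lt_irrefl, false_and, or_false, exists_const, ne_eq,
    Sigma.mk.injEq, heq_eq_eq, true_and]
  exact ⟨fun h => h.2.elim id fun h => h.symm, fun h => ⟨h.ne, Or.inl h⟩⟩

lemma iterComp_adj_of_ne {p q : Σ i, Vi i} (h : p.1 ≠ q.1) :
    (iterComp Gi A).Adj p q ↔ (q.1 < p.1 ∧ p.2 ∈ A p.1) ∨ (p.1 < q.1 ∧ q.2 ∈ A q.1) := by
  have hpq : p ≠ q := fun e => h (congrArg _ e)
  simp [iterComp, fromRel_adj, h, h.symm, hpq]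

/-- The degree in an iterated composition is the degree in the component plus a number that does
not depend on the edges inside components. -/
lemma ncard_neighborSet_iterComp [∀ i, Finite (Vi i)] (i : Fin (k + 1)) (x : Vi i) :
    ((iterComp Gi A).neighborSet ⟨i, x⟩).ncard = ((Gi i).neighborSet x).ncard +
      {q : Σ i, Vi i | i ≠ q.1 ∧ ((q.1 < i ∧ x ∈ A i) ∨ (i < q.1 ∧ q.2 ∈ A q.1))}.ncard := by
  rw [← Set.ncard_image_of_injective _ (sigma_mk_injective (i := i)), ← Set.ncard_union_eq]
  · congr 1
    ext ⟨j, y⟩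
    by_cases h : i = j
    · subst h
      simp [iterComp_adj_mk]
    · have : ∀ z : Vi i, (⟨i, z⟩ : Σ i, Vi i) ≠ ⟨j, y⟩ := fun z e => h (congrArg Sigma.fst e)
      simp [iterComp_adj_of_ne, h]
  · rw [Set.disjoint_left]
    rintro _ ⟨y, -, rfl⟩ ⟨h, -⟩
    exact h rfl

/-- The weight of a vertex of the `i`-th component: `i` in the clique part, `-i` elsewhere. -/
noncomputable def level (A : ∀ i, Set (Vi i)) (p : Σ i, Vi i) : ℤ :=
  open Classical in if p.2 ∈ A p.1 then (p.1 : ℤ) else -(p.1 : ℤ)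

lemma weightCompatible_iterComp (hKS : ∀ i, i ≠ 0 → IsKSPartition (Gi i) (A i) (B i)) :
    WeightCompatible (level A) (iterComp Gi A) := by
  rintro ⟨i, x⟩ ⟨j, y⟩ hne
  by_cases hij : i = j
  · subst hij
    have hxy : x ≠ y := fun e => hne (e ▸ rfl)
    rw [iterComp_adj_mk]
    by_cases hi : i = 0
    · subst hi
      simp [level]
    · have h := hKS i hi
      have hx := h.mem_right (v := x)
      have hy := h.mem_right (v := y)
      have h1 := @h.1 x
      have h2 := @h.2.1 x
      unfold level
      constructor <;> intro h0 <;> split_ifs at h0 <;> grind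
  · rw [iterComp_adj_of_ne hij]
    unfold level
    have : (i : ℕ) ≠ j := fun e => hij (Fin.ext e)
    constructor <;> intro h0 <;> split_ifs at h0 <;> grind

lemma WeightCompatible.eq_iterComp {H : SimpleGraph (Σ i, Vi i)}
    (h : WeightCompatible (level A) H) :
    H = iterComp (fun i => H.comap (Sigma.mk i)) A := by
  ext ⟨i, x⟩ ⟨j, y⟩
  by_cases hij : i = j
  · subst hij
    simp [iterComp_adj_mk]
  · have hc := h ⟨i, x⟩ ⟨j, y⟩ fun e => hij (congrArg Sigma.fst e)
    rw [iterComp_adj_of_ne hij]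
    unfold level at hc
    have : (i : ℕ) ≠ j := fun e => hij (Fin.ext e)
    simp only [Fin.lt_def]
    by_cases hx : x ∈ A i <;> by_cases hy : y ∈ A j <;>
      simp only [hx, hy, if_true, if_false] at hc <;>
      by_cases hlt : (i : ℕ) < j <;> grind

lemma WeightCompatible.isKSPartition_comap {H : SimpleGraph (Σ i, Vi i)}
    (h : WeightCompatible (level A) H) {i : Fin (k + 1)} (hi : i ≠ 0) :
    IsKSPartition (H.comap (Sigma.mk i)) (A i) (A i)ᶜ := by
  have hi' : 0 < (i : ℤ) := by exact_mod_cast Fin.pos_of_ne_zero hi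
  have hne : ∀ {x y : Vi i}, x ≠ y → (⟨i, x⟩ : Σ i, Vi i) ≠ ⟨i, y⟩ := fun hxy e =>
    hxy (sigma_mk_injective e)
  refine ⟨fun x hx y hy hxy => (h _ _ (hne hxy)).1 ?_,
    fun x hx y hy hxy => (h _ _ (hne hxy)).2 ?_, Set.union_compl_self _, disjoint_compl_right⟩
  · simp only [level, hx, hy, if_true]
    omega
  · rw [Set.mem_compl_iff] at hx hy
    simp only [level, hx, hy, if_false]
    omega

/-- Vertices of equal degree in different indecomposable components belong to trivial
components. -/
lemma subsingleton_of_ncard_neighborSet_eq [∀ i, Finite (Vi i)]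
    (hKS : ∀ i, i ≠ 0 → IsKSPartition (Gi i) (A i) (B i))
    (hindec : ∀ i, ¬ Decomposable (Gi i)) {i j : Fin (k + 1)} (hij : j < i) {x : Vi i} {y : Vi j}
    (hdeg : ((iterComp Gi A).neighborSet ⟨i, x⟩).ncard =
      ((iterComp Gi A).neighborSet ⟨j, y⟩).ncard) :
    Subsingleton (Vi i) ∧ Subsingleton (Vi j) := by
  have hks := hKS i (Fin.ne_zero_of_lt hij)
  have hne : ∀ {l : Fin (k + 1)} {u v : Vi l}, u ≠ v → (⟨l, u⟩ : Σ i, Vi i) ≠ ⟨l, v⟩ :=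
    fun h e => h (sigma_mk_injective e)
  have hx' : ∀ q : Σ i, Vi i, i ≠ q.1 → ((iterComp Gi A).Adj ⟨i, x⟩ q ↔ _) :=
    fun q h => iterComp_adj_of_ne h
  have hy' : ∀ q : Σ i, Vi i, j ≠ q.1 → ((iterComp Gi A).Adj ⟨j, y⟩ q ↔ _) :=
    fun q h => iterComp_adj_of_ne h
  simp only at hx' hy'
  by_cases hx : x ∈ A i
  · have hxy : (iterComp Gi A).Adj ⟨i, x⟩ ⟨j, y⟩ :=
      (iterComp_adj_of_ne hij.ne').2 (Or.inl ⟨hij, hx⟩)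
    have hsub : insert ⟨j, y⟩ ((iterComp Gi A).neighborSet ⟨j, y⟩) ⊆
        insert ⟨i, x⟩ ((iterComp Gi A).neighborSet ⟨i, x⟩) := by
      rintro q (rfl | hq)
      · exact Or.inr hxy
      · by_cases hqx : q = ⟨i, x⟩
        · exact Or.inl hqx
        refine Or.inr ?_
        obtain ⟨l, u⟩ := q
        rw [mem_neighborSet] at hq ⊢
        rcases lt_trichotomy l i with hl | rfl | hl
        · exact (hx' _ hl.ne').2 (Or.inl ⟨hl, hx⟩)
        · rw [hy' _ hij.ne] at hq
          have hu : u ∈ A l := by grind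
          exact iterComp_adj_mk.2 (hks.1 hx hu fun e => hqx (e ▸ rfl))
        · rw [hy' _ (hij.trans hl).ne] at hq
          exact (hx' _ hl.ne).2 (Or.inr ⟨hl, by grind⟩)
    have heq := Set.eq_of_subset_of_ncard_le hsub (by
      rw [Set.ncard_insert_of_notMem (by simp), Set.ncard_insert_of_notMem (by simp), hdeg])
    constructor <;> rw [← not_nontrivial_iff_subsingleton] <;> intro hnt
    · refine hindec i (hks.decomposable_of_mem_left hx fun b hb hxb => ?_)
      have hmem : (⟨i, b⟩ : Σ i, Vi i) ∈ insert ⟨j, y⟩ ((iterComp Gi A).neighborSet ⟨j, y⟩) :=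
        heq ▸ Or.inr (iterComp_adj_mk.2 hxb)
      rcases hmem with e | hmem
      · exact hij.ne' (congrArg Sigma.fst e)
      · rw [mem_neighborSet, hy' _ hij.ne] at hmem
        have := hks.mem_right.1 hb
        grind
    · refine hindec j (decomposable_of_dominating (v := y) fun u hu => ?_)
      have hmem : (⟨j, u⟩ : Σ i, Vi i) ∈ insert ⟨j, y⟩ ((iterComp Gi A).neighborSet ⟨j, y⟩) :=
        heq ▸ Or.inr ((hx' _ hij.ne').2 (Or.inl ⟨hij, hx⟩))
      exact iterComp_adj_mk.1 (hmem.resolve_left (hne hu))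
  · have hsub : (iterComp Gi A).neighborSet ⟨i, x⟩ ⊆ (iterComp Gi A).neighborSet ⟨j, y⟩ := by
      rintro ⟨l, u⟩ hq
      rw [mem_neighborSet] at hq ⊢
      rcases lt_trichotomy l i with hl | rfl | hl
      · rw [hx' _ hl.ne'] at hq
        grind
      · rw [iterComp_adj_mk] at hq
        have hu : u ∈ A l := by
          by_contra hu
          exact hks.2.1 (hks.mem_right.2 hx) (hks.mem_right.2 hu) hq.ne hq
        exact (hy' _ hij.ne).2 (Or.inr ⟨hij, hu⟩)
      · rw [hx' _ hl.ne] at hq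
        exact (hy' _ (hij.trans hl).ne).2 (Or.inr ⟨hij.trans hl, by grind⟩)
    have heq := Set.eq_of_subset_of_ncard_le hsub hdeg.ge
    constructor <;> rw [← not_nontrivial_iff_subsingleton] <;> intro hnt
    · refine hindec i (hks.decomposable_of_mem_right (hks.mem_right.2 hx) fun a ha => ?_)
      have hmem : (⟨i, a⟩ : Σ i, Vi i) ∈ (iterComp Gi A).neighborSet ⟨j, y⟩ :=
        (hy' _ hij.ne).2 (Or.inr ⟨hij, ha⟩)
      rw [← heq] at hmem
      exact iterComp_adj_mk.1 hmem
    · refine hindec j (decomposable_of_isolated (v := y) fun u hu hyu => ?_)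
      have hmem : (⟨j, u⟩ : Σ i, Vi i) ∈ (iterComp Gi A).neighborSet ⟨j, y⟩ :=
        iterComp_adj_mk.2 hyu
      rw [← heq, mem_neighborSet, hx' _ hij.ne'] at hmem
      grind

/-- Degree-preserving isomorphisms between iterated compositions restrict to the nontrivial
components. -/
lemma nonempty_iso_component [∀ i, Finite (Vi i)]
    (hKS : ∀ i, i ≠ 0 → IsKSPartition (Gi i) (A i) (B i))
    (hindec : ∀ i, ¬ Decomposable (Gi i))
    (hdeg : ∀ p, ((iterComp Hi A).neighborSet p).ncard = ((iterComp Gi A).neighborSet p).ncard)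
    (φ : iterComp Gi A ≃g iterComp Hi A) (i : Fin (k + 1)) : Nonempty (Gi i ≃g Hi i) := by
  rcases subsingleton_or_nontrivial (Vi i) with hs | hn
  · exact ⟨⟨Equiv.refl _, fun {x y} => by simp [Subsingleton.elim x y]⟩⟩
  have hφ : ∀ x : Vi i, ∃ y : Vi i, φ ⟨i, x⟩ = ⟨i, y⟩ := fun x => by
    obtain ⟨j, y, hq⟩ : ∃ j y, φ ⟨i, x⟩ = ⟨j, y⟩ := ⟨_, _, rfl⟩
    have hd := ncard_neighborSet_iso φ ⟨i, x⟩
    rw [hq, hdeg] at hd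
    rcases lt_trichotomy j i with hl | rfl | hl
    · exact absurd (subsingleton_of_ncard_neighborSet_eq hKS hindec hl hd.symm).1
        (not_subsingleton _)
    · exact ⟨y, hq⟩
    · exact absurd (subsingleton_of_ncard_neighborSet_eq hKS hindec hl hd).2
        (not_subsingleton _)
  choose f hf using hφ
  have hinj : Function.Injective f := fun x y hxy =>
    sigma_mk_injective (φ.injective (by rw [hf, hf, hxy]))
  refine ⟨⟨Equiv.ofBijective f (Finite.injective_iff_bijective.1 hinj), fun {x y} => ?_⟩⟩
  rw [← iterComp_adj_mk (Gi := Gi) (A := A), ← φ.map_adj_iff, hf, hf, iterComp_adj_mk]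
  rfl

/-- Isomorphisms between components that respect the clique parts assemble to an isomorphism
between iterated compositions. -/
def iterCompCongr (φ : ∀ i, Gi i ≃g Hi i) (hφ : ∀ i x, φ i x ∈ A i ↔ x ∈ A i) :
    iterComp Gi A ≃g iterComp Hi A where
  toEquiv := Equiv.sigmaCongrRight fun i => (φ i).toEquiv
  map_rel_iff' := by
    rintro ⟨i, x⟩ ⟨j, y⟩
    by_cases hij : i = j
    · subst hij
      exact iterComp_adj_mk.trans ((φ i).map_adj_iff.trans iterComp_adj_mk.symm)
    · rw [iterComp_adj_of_ne hij, iterComp_adj_of_ne (by exact hij)]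
      exact or_congr (and_congr_right' (hφ i x)) (and_congr_right' (hφ j y))

end IterComp

lemma IsKSPartition.preimage {W : Type} {G : SimpleGraph V} {H : SimpleGraph W} {A B : Set W}
    (h : IsKSPartition H A B) (φ : G ≃g H) : IsKSPartition G (φ ⁻¹' A) (φ ⁻¹' B) :=
  ⟨fun _ hx _ hy hxy => φ.map_adj_iff.1 (h.1 hx hy (φ.injective.ne hxy)),
    fun _ hx _ hy hxy hadj => h.2.1 hx hy (φ.injective.ne hxy) (φ.map_adj_iff.2 hadj),
    by rw [← Set.preimage_union, h.2.2.1, Set.preimage_univ], h.2.2.2.preimage φ⟩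

/-- **Tyshkevich.** A graph is a unigraph iff every indecomposable component in its
canonical decomposition is a unigraph. -/
theorem unigraph_iff_components_unigraph {V : Type} [Fintype V] (G : SimpleGraph V)
    {k : ℕ} (Vi : Fin (k + 1) → Type) [∀ i, Fintype (Vi i)] [∀ i, Nonempty (Vi i)]
    (Gi : ∀ i, SimpleGraph (Vi i)) (A B : ∀ i, Set (Vi i))
    (hKS : ∀ i, i ≠ 0 → IsKSPartition (Gi i) (A i) (B i))
    (hA0 : A 0 = ∅) (hB0 : B 0 = ∅)
    (hindec : ∀ i, ¬ Decomposable (Gi i))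
    (hiso : Nonempty (G ≃g iterComp Gi A)) :
    Unigraph G ↔ ∀ i, Unigraph (Gi i) := by
  obtain ⟨e⟩ := hiso
  rw [show Unigraph G ↔ Unigraph (iterComp Gi A) from ⟨.of_iso e, .of_iso e.symm⟩, unigraph_iff]
  simp only [unigraph_iff (G := Gi _)]
  constructor
  · intro h i H hH
    have hdeg : ∀ p, ((iterComp (Function.update Gi i H) A).neighborSet p).ncard =
        ((iterComp Gi A).neighborSet p).ncard := by
      rintro ⟨j, x⟩
      rw [ncard_neighborSet_iterComp, ncard_neighborSet_iterComp]
      by_cases hj : j = i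
      · subst hj
        rw [Function.update_self, hH]
      · rw [Function.update_of_ne hj]
    obtain ⟨φ⟩ := h _ hdeg
    simpa using nonempty_iso_component hKS hindec hdeg φ i
  · intro h H hH
    have hc := (weightCompatible_iterComp hKS).of_degree_eq hH
    have hHc := hc.eq_iterComp
    have hiso : ∀ i, ∃ φ : Gi i ≃g H.comap (Sigma.mk i), ∀ x, φ x ∈ A i ↔ x ∈ A i := fun i => by
      obtain ⟨φ⟩ := h i (H.comap (Sigma.mk i)) fun x => by
        have hx := hH ⟨i, x⟩
        rw [hHc, ncard_neighborSet_iterComp, ncard_neighborSet_iterComp] at hx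
        exact Nat.add_right_cancel hx
      refine ⟨φ, fun x => ?_⟩
      by_cases hi : i = 0
      · subst hi
        simp [hA0]
      · have hA := ((hc.isKSPartition_comap hi).preimage φ).eq_of_ncard_eq (hKS i hi) (hindec i)
          (Set.ncard_preimage_of_injective_subset_range φ.injective
            (by simp [φ.surjective.range_eq]))
        exact Set.ext_iff.1 hA x
    choose φ hφ using hiso
    rw [hHc]
    exact ⟨iterCompCongr φ hφ⟩

end Tysh
end
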